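/- Suppose a group G acts specially on a quasi-median graph X, and suppose there exists D ∈ ℕ such that |Stab_G(w)| ≤ D for every vertex w of X and every vertex of the quotient graph ΔX/G has at most D neighbours. Then the induced action of G on the contact graph CX is acylindrical, and the acylindricity constants D_ε and N_ε can be chosen as functions of ε and D only; explicitly, for every ε ∈ ℕ one may take D_ε = 2ε+6 and N_ε = D·N^{2(ε+3)}/(N−1)^2, where N = (D+1)^2·2^{D+1}. -/

import Mathlib

namespace QM

variable {V : Type*}

/-- `y₁` and `y₂` lie (in this order) on a common geodesic from `x₁` to `x₂`. -/
def OnGeod (X : SimpleGraph V) (x₁ y₁ y₂ x₂ : V) : Prop :=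
  X.dist x₁ y₁ + X.dist y₁ y₂ + X.dist y₂ x₂ = X.dist x₁ x₂

/-- `(y₁, y₂, y₃)` is a `k`-quasi-median triple for `(x₁, x₂, x₃)` (without minimality). -/
def IsQMTriple (X : SimpleGraph V) (x₁ x₂ x₃ y₁ y₂ y₃ : V) (k : ℕ) : Prop :=
  OnGeod X x₁ y₁ y₂ x₂ ∧ OnGeod X x₁ y₁ y₃ x₃ ∧ OnGeod X x₂ y₂ y₃ x₃ ∧
    X.dist y₁ y₂ = k ∧ X.dist y₁ y₃ = k ∧ X.dist y₂ y₃ = k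

/-- `y` is a quasi-median of the triple `(x₁, x₂, x₃)`: it is a `k`-quasi-median triple
with `k` as small as possible. -/
def IsQuasiMedianTriple (X : SimpleGraph V) (x₁ x₂ x₃ : V) (y : V × V × V) : Prop :=
  ∃ k : ℕ, IsQMTriple X x₁ x₂ x₃ y.1 y.2.1 y.2.2 k ∧
    ∀ (k' : ℕ) (z₁ z₂ z₃ : V), IsQMTriple X x₁ x₂ x₃ z₁ z₂ z₃ k' → k ≤ k'

/-- The complete multipartite graph `K_{1,1,2}`: the complete graph on four vertices
with the edge between vertices `2` and `3` removed. -/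
def K112 : SimpleGraph (Fin 4) :=
  SimpleGraph.fromRel (fun i j => ¬(i = 2 ∧ j = 3) ∧ ¬(i = 3 ∧ j = 2))

/-- The 1-skeleton of the 3-cube. -/
def cubeGraph : SimpleGraph (Fin 3 → Bool) :=
  SimpleGraph.fromRel (fun x y => ∃! i, x i ≠ y i)

/-- The 6-cycle. -/
def C6 : SimpleGraph (Fin 6) := SimpleGraph.fromRel (fun i j => j = i + 1)

/-- A set of vertices is convex if it contains every vertex lying on a geodesic between
two of its members. -/
def IsConvexSet (X : SimpleGraph V) (S : Set V) : Prop :=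
  ∀ x ∈ S, ∀ y ∈ S, ∀ z : V, X.dist x z + X.dist z y = X.dist x y → z ∈ S

/-- The convex hull of a set of vertices. -/
def convexHullSet (X : SimpleGraph V) (S : Set V) : Set V :=
  ⋂₀ {T : Set V | S ⊆ T ∧ IsConvexSet X T}

/-- A quasi-median graph: a connected graph in which every triple of vertices has a unique
quasi-median, with no induced `K_{1,1,2}`, and in which the convex hull of every isometrically
embedded 6-cycle is isomorphic to the 3-cube. -/
structure IsQuasiMedian (X : SimpleGraph V) : Prop where
  connected : X.Connected
  uniqueQuasiMedian : ∀ x₁ x₂ x₃ : V, ∃! y : V × V × V, IsQuasiMedianTriple X x₁ x₂ x₃ y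
  noK112 : IsEmpty (SimpleGraph.Embedding K112 X)
  hullOfC6IsCube : ∀ f : Fin 6 → V,
    (∀ i j, C6.Adj i j → X.Adj (f i) (f j)) →
    (∀ i j, X.dist (f i) (f j) = C6.dist i j) →
    Nonempty (SimpleGraph.Iso
      (SimpleGraph.induce (convexHullSet X (Set.range f)) X) cubeGraph)

/-- Two edges are two sides of a common triangle, or opposite sides of a common square. -/
def SideRel (X : SimpleGraph V) (e f : Sym2 V) : Prop :=
  (∃ a b c : V, X.Adj a b ∧ X.Adj a c ∧ X.Adj b c ∧ e = s(a, b) ∧ f = s(a, c)) ∨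
  (∃ a b c d : V, X.Adj a b ∧ X.Adj c d ∧ X.Adj a c ∧ X.Adj b d ∧ a ≠ d ∧ b ≠ c ∧
    e = s(a, b) ∧ f = s(c, d))

/-- The equivalence class of an edge under the equivalence relation generated by `SideRel`. -/
def hypClass (X : SimpleGraph V) (e : Sym2 V) : Set (Sym2 V) :=
  {f | Relation.EqvGen (SideRel X) e f}

/-- A hyperplane: the equivalence class of some edge of `X`. -/
def IsHyperplane (X : SimpleGraph V) (H : Set (Sym2 V)) : Prop :=
  ∃ e ∈ X.edgeSet, H = hypClass X e

/-- The type of hyperplanes of `X`. -/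
def Hyperplane (X : SimpleGraph V) := {H : Set (Sym2 V) // IsHyperplane X H}

/-- Edges `e`, `e'` sharing the endpoint `p`, not lying in a common clique, that are
adjacent sides of a square of `X`: their dual hyperplanes intersect at `p`. -/
def IntersectAt (X : SimpleGraph V) (e e' : Sym2 V) (p : V) : Prop :=
  ∃ a b : V, e = s(p, a) ∧ e' = s(p, b) ∧ X.Adj p a ∧ X.Adj p b ∧ a ≠ b ∧ ¬ X.Adj a b ∧
    ∃ q : V, q ≠ p ∧ X.Adj a q ∧ X.Adj b q

/-- Edges `e`, `e'` sharing the endpoint `p`, not lying in a common clique, and not adjacent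
sides of any square of `X`: their dual hyperplanes osculate at `p`. -/
def OsculateAt (X : SimpleGraph V) (e e' : Sym2 V) (p : V) : Prop :=
  ∃ a b : V, e = s(p, a) ∧ e' = s(p, b) ∧ X.Adj p a ∧ X.Adj p b ∧ a ≠ b ∧ ¬ X.Adj a b ∧
    ¬ ∃ q : V, q ≠ p ∧ X.Adj a q ∧ X.Adj b q

/-- Hyperplanes `H` and `H'` intersect at `p`. -/
def HypIntersectAt (X : SimpleGraph V) (H H' : Hyperplane X) (p : V) : Prop :=
  ∃ e ∈ H.1, ∃ e' ∈ H'.1, IntersectAt X e e' p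

/-- Hyperplanes `H` and `H'` osculate at `p`. -/
def HypOsculateAt (X : SimpleGraph V) (H H' : Hyperplane X) (p : V) : Prop :=
  ∃ e ∈ H.1, ∃ e' ∈ H'.1, OsculateAt X e e' p

/-- Hyperplanes `H` and `H'` intersect. -/
def HypIntersect (X : SimpleGraph V) (H H' : Hyperplane X) : Prop :=
  ∃ p : V, HypIntersectAt X H H' p

/-- Hyperplanes `H` and `H'` osculate. -/
def HypOsculate (X : SimpleGraph V) (H H' : Hyperplane X) : Prop :=
  ∃ p : V, HypOsculateAt X H H' p

/-- The contact graph `𝒞X`: hyperplanes are adjacent iff they intersect or osculate. -/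
def contactGraph (X : SimpleGraph V) : SimpleGraph (Hyperplane X) :=
  SimpleGraph.fromRel (fun H H' => HypIntersect X H H' ∨ HypOsculate X H H')

/-- The crossing graph `ΔX`: hyperplanes are adjacent iff they intersect. -/
def crossingGraph (X : SimpleGraph V) : SimpleGraph (Hyperplane X) :=
  SimpleGraph.fromRel (fun H H' => HypIntersect X H H')

/-- The (vertex set of the) carrier of a hyperplane: all endpoints of its edges. -/
def hypCarrier (X : SimpleGraph V) (H : Hyperplane X) : Set V :=
  {v : V | ∃ e ∈ H.1, v ∈ e}

/-- A set of edges `H` (e.g. a hyperplane) separates `p` from `q` if every walk from `p`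
to `q` uses an edge of `H`. -/
def Separates (X : SimpleGraph V) (H : Set (Sym2 V)) (p q : V) : Prop :=
  ∀ w : X.Walk p q, ∃ e ∈ w.edges, e ∈ H

/-- `f` is a `(λ, c)`-quasi-isometry from `(A, dA)` to `(B, dB)`. -/
def IsQuasiIsometry {A B : Type*} (lam c : ℝ) (dA : A → A → ℝ) (dB : B → B → ℝ)
    (f : A → B) : Prop :=
  (∀ x y : A, dA x y / lam - c ≤ dB (f x) (f y) ∧ dB (f x) (f y) ≤ lam * dA x y + c) ∧
    ∀ b : B, ∃ a : A, dB (f a) b ≤ c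

end QM

namespace QM

variable {V : Type*} {G : Type*} [Group G]

/-- An action of a group `G` on a graph `X` by graph automorphisms. -/
structure GraphAction (G : Type*) [Group G] {V : Type*} (X : SimpleGraph V) where
  act : G → V → V
  act_one : ∀ v, act 1 v = v
  act_mul : ∀ g h v, act (g * h) v = act g (act h v)
  act_adj : ∀ g a b, X.Adj (act g a) (act g b) ↔ X.Adj a b

/-- The image of a set of edges under the action of `g`. -/
def GraphAction.hypImage {X : SimpleGraph V} (α : GraphAction G X) (g : G)
    (H : Set (Sym2 V)) : Set (Sym2 V) :=
  Sym2.map (α.act g) '' H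

/-- Two hyperplanes are in the same orbit of the induced action of `G` on hyperplanes. -/
def SameOrbit {X : SimpleGraph V} (α : GraphAction G X) (H H' : Hyperplane X) : Prop :=
  ∃ g : G, H'.1 = α.hypImage g H.1

/-- The set of `G`-orbits of hyperplanes. -/
def HypOrbit {X : SimpleGraph V} (α : GraphAction G X) := Quot (SameOrbit α)

/-- The quotient graph `ΔX/G`: vertices are `G`-orbits of hyperplanes, two orbits being
adjacent iff some representatives are adjacent in the crossing graph `ΔX`. -/
def quotCrossingGraph {X : SimpleGraph V} (α : GraphAction G X) :
    SimpleGraph (HypOrbit α) :=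
  SimpleGraph.fromRel (fun O O' => ∃ H H' : Hyperplane X,
    Quot.mk (SameOrbit α) H = O ∧ Quot.mk (SameOrbit α) H' = O' ∧ (crossingGraph X).Adj H H')

/-- Every vertex of the quotient graph `ΔX/G` has at most `D` neighbours. -/
def QuotDegBounded {X : SimpleGraph V} (α : GraphAction G X) (D : ℕ) : Prop :=
  ∀ O : HypOrbit α, ((quotCrossingGraph α).neighborSet O).Finite ∧
    ((quotCrossingGraph α).neighborSet O).ncard ≤ D

/-- The action is special: (i) no two distinct hyperplanes in the same `G`-orbit intersect
or osculate; (ii) if two hyperplanes intersect, then no `G`-translate of the first osculates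
with the second. -/
def IsSpecial {X : SimpleGraph V} (α : GraphAction G X) : Prop :=
  (∀ H H' : Hyperplane X, SameOrbit α H H' → H ≠ H' →
      ¬(HypIntersect X H H' ∨ HypOsculate X H H')) ∧
  (∀ H H' K : Hyperplane X, HypIntersect X H H' → SameOrbit α H K →
      ¬ HypOsculate X K H')

/-- The `g`-translate of the hyperplane `A` is within contact-graph distance `ε` of `A`. -/
def TranslateDistLE {X : SimpleGraph V} (α : GraphAction G X) (g : G)
    (A : Hyperplane X) (ε : ℝ) : Prop :=
  ∃ A' : Hyperplane X, A'.1 = α.hypImage g A.1 ∧ ((contactGraph X).dist A A' : ℝ) ≤ ε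

end QM

namespace QM

section WeaklyModular

variable {V : Type*} {X : SimpleGraph V}

theorem dist_le_one_of_adj {a b : V} (h : X.Adj a b) : X.dist a b = 1 :=
  SimpleGraph.dist_eq_one_iff_adj.2 h

theorem exists_adj_dist (hc : X.Connected) {o x : V} (h : x ≠ o) :
    ∃ y, X.Adj x y ∧ X.dist o y + 1 = X.dist o x := by
  obtain ⟨w, hw⟩ := hc.exists_walk_length_eq_dist x o
  cases w with
  | nil => exact absurd rfl h
  | @cons _ y _ hxy p =>
    refine ⟨y, hxy, ?_⟩
    have h1 : X.dist y o ≤ p.length := SimpleGraph.dist_le p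
    have h2 := hc.dist_triangle (u := x) (v := y) (w := o)
    rw [dist_le_one_of_adj hxy] at h2
    simp only [SimpleGraph.Walk.length_cons] at hw
    rw [X.dist_comm (u := o), X.dist_comm (u := o)]
    omega

theorem dist_adj_le (hc : X.Connected) (o : V) {x y : V} (h : X.Adj x y) :
    X.dist o x ≤ X.dist o y + 1 := by
  have := hc.dist_triangle (u := o) (v := y) (w := x)
  rw [X.dist_comm (u := y), dist_le_one_of_adj h] at this
  exact this

theorem dist_eq_two (hc : X.Connected) {x y z : V} (hz : X.Adj z x) (hz' : X.Adj z y) (hxy : x ≠ y)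
    (hn : ¬ X.Adj x y) : X.dist x y = 2 := by
  have h1 := dist_adj_le hc x hz'.symm
  rw [dist_le_one_of_adj hz.symm] at h1
  have h0 : X.dist x y ≠ 0 := fun h => hxy (hc.dist_eq_zero_iff.1 h)
  have h2 : X.dist x y ≠ 1 := fun h => hn (SimpleGraph.dist_eq_one_iff_adj.1 h)
  omega

theorem exists_adj_of_dist_eq_two (hc : X.Connected) {x y : V} (h : X.dist x y = 2) :
    ∃ z, X.Adj x z ∧ X.Adj y z := by
  have hne : y ≠ x := by
    rintro rfl
    simp at h
  obtain ⟨z, hz, hz'⟩ := exists_adj_dist hc hne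
  exact ⟨z, SimpleGraph.dist_eq_one_iff_adj.1 (by omega), hz⟩

theorem k112 (hX : IsQuasiMedian X) {a b c d : V} (hab : X.Adj a b) (hac : X.Adj a c)
    (had : X.Adj a d) (hbc : X.Adj b c) (hbd : X.Adj b d) (hcd : c ≠ d) : X.Adj c d := by
  by_contra hn
  have hn' : ¬ X.Adj d c := fun h => hn h.symm
  refine hX.noK112.false ⟨⟨![a, b, c, d], ?_⟩, ?_⟩
  · intro i j hij
    have := hab.ne; have := hac.ne; have := had.ne; have := hbc.ne; have := hbd.ne
    fin_cases i <;> fin_cases j <;> simp_all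
  · intro i j
    change X.Adj (![a, b, c, d] i) (![a, b, c, d] j) ↔ K112.Adj i j
    have := hab.symm; have := hac.symm; have := had.symm; have := hbc.symm; have := hbd.symm
    fin_cases i <;> fin_cases j <;> simp_all [K112, SimpleGraph.fromRel_adj]

theorem exists_quasiMedian (hX : IsQuasiMedian X) (x₁ x₂ x₃ : V) :
    ∃ k y₁ y₂ y₃, IsQMTriple X x₁ x₂ x₃ y₁ y₂ y₃ k ∧
    ∀ (k' : ℕ) (z₁ z₂ z₃ : V), IsQMTriple X x₁ x₂ x₃ z₁ z₂ z₃ k' → k ≤ k' := by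
  obtain ⟨⟨y₁, y₂, y₃⟩, ⟨k, h⟩, -⟩ := hX.uniqueQuasiMedian x₁ x₂ x₃
  exact ⟨k, y₁, y₂, y₃, h⟩

theorem tc (hX : IsQuasiMedian X) {o x y : V} (hxy : X.Adj x y) (h : X.dist o x = X.dist o y) :
    ∃ z, X.Adj x z ∧ X.Adj y z ∧ X.dist o z + 1 = X.dist o x := by
  obtain ⟨k, o', x', y', ⟨h1, h2, h3, h4, h5, h6⟩, -⟩ := exists_quasiMedian hX o x y
  have hc := hX.connected
  have hd := dist_le_one_of_adj hxy
  simp only [OnGeod] at h1 h2 h3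
  have e1 := X.dist_comm (u := x) (v := x')
  have e2 := X.dist_comm (u := y) (v := y')
  have e3 := X.dist_comm (u := o') (v := x')
  have e4 := X.dist_comm (u := o') (v := y')
  obtain rfl | rfl : k = 0 ∨ k = 1 := by omega
  · omega
  · have hx : x = x' := hc.dist_eq_zero_iff.1 (by omega)
    have hy : y = y' := hc.dist_eq_zero_iff.1 (by omega)
    subst hx hy
    exact ⟨o', SimpleGraph.dist_eq_one_iff_adj.1 (by omega),
      SimpleGraph.dist_eq_one_iff_adj.1 (by omega), by omega⟩

theorem k23 (hX : IsQuasiMedian X) {u v w a b : V} (huv : u ≠ v) (huw : u ≠ w) (hvw : v ≠ w)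
    (nuv : ¬ X.Adj u v) (nuw : ¬ X.Adj u w) (nvw : ¬ X.Adj v w)
    (au : X.Adj a u) (av : X.Adj a v) (aw : X.Adj a w)
    (bu : X.Adj b u) (bv : X.Adj b v) (bw : X.Adj b w) : a = b := by
  have hc := hX.connected
  obtain ⟨y, -, hy⟩ := hX.uniqueQuasiMedian u v w
  have key : ∀ c, X.Adj c u → X.Adj c v → X.Adj c w →
      IsQuasiMedianTriple X u v w (c, c, c) := by
    intro c cu cv cw
    refine ⟨0, ?_, fun _ _ _ _ _ => Nat.zero_le _⟩
    have := dist_eq_two hc cu cv huv nuv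
    have := dist_eq_two hc cu cw huw nuw
    have := dist_eq_two hc cv cw hvw nvw
    have := dist_le_one_of_adj cu.symm
    have := dist_le_one_of_adj cv.symm
    have := dist_le_one_of_adj cv
    have := dist_le_one_of_adj cw
    simp only [IsQMTriple, OnGeod, SimpleGraph.dist_self]
    refine ⟨by omega, by omega, by omega, by simp⟩
  have := (hy _ (key a au av aw)).trans (hy _ (key b bu bv bw)).symm
  exact congrArg Prod.fst this

theorem not_two_lower (hX : IsQuasiMedian X) {o x y z : V} (hzx : X.Adj z x) (hzy : X.Adj z y)
    (hxy : X.Adj x y) (h1 : X.dist o x + 1 = X.dist o z) (h2 : X.dist o y + 1 = X.dist o z) :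
    False := by
  obtain ⟨t, hxt, hyt, ht⟩ := tc hX hxy (by omega : X.dist o x = X.dist o y)
  have hne : z ≠ t := by
    rintro rfl
    omega
  have := k112 hX hxy hzx.symm hxt hzy.symm hyt hne
  have := dist_adj_le hX.connected o this
  omega

end WeaklyModular

end QM

namespace QM

section Quadrangle

theorem c6_adj (i j : Fin 6) : C6.Adj i j ↔ i ≠ j ∧ (j = i + 1 ∨ i = j + 1) := Iff.rfl

theorem c6_dist (i j : Fin 6) : C6.dist i j = min (j - i).val (i - j).val := by
  have hadj : ∀ i : Fin 6, C6.Adj i (i + 1) := by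
    intro i
    rw [c6_adj]
    revert i
    decide
  have hlow : ∀ a b : Fin 6, C6.Adj a b →
      min (a - i).val (i - a).val ≤ min (b - i).val (i - b).val + 1 := by
    simp only [c6_adj]
    revert i
    decide
  have hw : ∀ (a : Fin 6) (w : C6.Walk a i), min (a - i).val (i - a).val ≤ w.length := by
    intro a w
    clear j
    induction w with
    | nil => simp
    | @cons a b i h p ih =>
      have := hlow _ _ h
      have := ih hlow
      simp only [SimpleGraph.Walk.length_cons]
      omega
  have h1 : ∀ k : Fin 6, C6.Reachable k (k + 1) := fun k => (hadj k).reachable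
  have h0 : ∀ n : ℕ, C6.Reachable 0 (Fin.ofNat 6 n) := by
    intro n
    induction n with
    | zero => exact SimpleGraph.Reachable.refl _
    | succ n ih =>
      have : Fin.ofNat 6 (n + 1) = Fin.ofNat 6 n + 1 := by
        ext
        simp [Fin.ofNat, Fin.val_add]
      rw [this]
      exact ih.trans (h1 _)
  have hr : ∀ a b : Fin 6, C6.Reachable a b := by
    intro a b
    have ha := h0 a.val
    have hb := h0 b.val
    simp only [Fin.ofNat_eq_cast, Fin.cast_val_eq_self] at ha hb
    exact ha.symm.trans hb
  have hup : ∀ a : Fin 6, ∀ n : ℕ, C6.dist a (a + Fin.ofNat 6 n) ≤ n := by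
    intro a n
    have key : ∃ w : C6.Walk a (a + Fin.ofNat 6 n), w.length = n := by
      induction n with
      | zero =>
        have : a + Fin.ofNat 6 0 = a := by simp
        rw [this]
        exact ⟨SimpleGraph.Walk.nil, rfl⟩
      | succ n ih =>
        obtain ⟨w, hw⟩ := ih
        have : a + Fin.ofNat 6 (n + 1) = a + Fin.ofNat 6 n + 1 := by
          have : Fin.ofNat 6 (n + 1) = Fin.ofNat 6 n + 1 := by
            ext
            simp [Fin.ofNat, Fin.val_add]
          rw [this, add_assoc]
        rw [this]
        exact ⟨w.concat (hadj _), by simp [hw]⟩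
    obtain ⟨w, hw⟩ := key
    exact (SimpleGraph.dist_le w).trans_eq hw
  apply le_antisymm
  · rw [le_min_iff]
    constructor
    · have := hup i (j - i).val
      simpa using this
    · have := hup j (i - j).val
      rw [SimpleGraph.dist_comm]
      simpa using this
  · obtain ⟨w, hw'⟩ := (hr j i).exists_walk_length_eq_dist
    rw [SimpleGraph.dist_comm, ← hw']
    exact hw j w

def adjBits (x y z a b c : Bool) : Bool :=
  (x != a && y == b && z == c) || (x == a && y != b && z == c) || (x == a && y == b && z != c)

theorem cube_adj (x y : Fin 3 → Bool) :
    cubeGraph.Adj x y ↔ adjBits (x 0) (x 1) (x 2) (y 0) (y 1) (y 2) = true := by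
  have hxy : x = y ↔ x 0 = y 0 ∧ x 1 = y 1 ∧ x 2 = y 2 := by
    rw [funext_iff, Fin.forall_fin_succ, Fin.forall_fin_succ, Fin.forall_fin_succ]
    simp
  simp only [cubeGraph, SimpleGraph.fromRel_adj, ExistsUnique, ne_eq, hxy]
  simp only [Fin.exists_fin_succ, Fin.forall_fin_succ]
  simp only [Fin.isValue, Fin.succ_zero_eq_one, Fin.succ_one_eq_two, IsEmpty.exists_iff,
    IsEmpty.forall_iff]
  generalize x 0 = a
  generalize x 1 = b
  generalize x 2 = c
  generalize y 0 = d
  generalize y 1 = e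
  generalize y 2 = f
  cases a <;> cases b <;> cases c <;> cases d <;> cases e <;> cases f <;> simp [adjBits]

theorem cube_median {z x y o : Fin 3 → Bool} (hzx : cubeGraph.Adj z x) (hzy : cubeGraph.Adj z y)
    (hxy : x ≠ y) (ho : o ≠ x) (ho' : o ≠ y) (ho'' : o ≠ z) (hox : ¬ cubeGraph.Adj o x)
    (hoy : ¬ cubeGraph.Adj o y) (hoz : ¬ cubeGraph.Adj o z) :
    ∃ w, cubeGraph.Adj w x ∧ cubeGraph.Adj w y ∧ cubeGraph.Adj w o := by
  have key : ∀ a b c a1 b1 c1 a2 b2 c2 u v w : Bool, adjBits a b c a1 b1 c1 = true →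
      adjBits a b c a2 b2 c2 = true → ¬ (a1 = a2 ∧ b1 = b2 ∧ c1 = c2) →
      ¬ (u = a1 ∧ v = b1 ∧ w = c1) → ¬ (u = a2 ∧ v = b2 ∧ w = c2) → ¬ (u = a ∧ v = b ∧ w = c) →
      ¬ (adjBits u v w a1 b1 c1 = true) → ¬ (adjBits u v w a2 b2 c2 = true) →
      ¬ (adjBits u v w a b c = true) → ∃ p q r, adjBits p q r a1 b1 c1 = true ∧
        adjBits p q r a2 b2 c2 = true ∧ adjBits p q r u v w = true := by
    intro a b c a1 b1 c1 a2 b2 c2 u v w h1 h2 h3 h4 h5 h6 h7 h8 h9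
    refine ⟨a1 && a2 || a1 && u || a2 && u, b1 && b2 || b1 && v || b2 && v,
      c1 && c2 || c1 && w || c2 && w, ?_⟩
    cases a <;> cases b <;> cases c <;> cases a1 <;> cases b1 <;> cases c1 <;>
      simp [adjBits] at h1 <;> cases a2 <;> cases b2 <;> cases c2 <;> simp [adjBits] at h2 h3 <;>
      cases u <;> cases v <;> cases w <;> simp [adjBits] at *
  have hne : ∀ {x y : Fin 3 → Bool}, x ≠ y → ¬ (x 0 = y 0 ∧ x 1 = y 1 ∧ x 2 = y 2) := by
    intro x y h h'
    apply h
    rw [funext_iff, Fin.forall_fin_succ, Fin.forall_fin_succ, Fin.forall_fin_succ]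
    simpa using h'
  simp only [cube_adj] at hzx hzy hox hoy hoz ⊢
  obtain ⟨p, q, r, h⟩ := key _ _ _ _ _ _ _ _ _ _ _ _ hzx hzy (hne hxy) (hne ho) (hne ho')
    (hne ho'') hox hoy hoz
  exact ⟨![p, q, r], h⟩

variable {V : Type*} {X : SimpleGraph V}

theorem subset_convexHullSet (S : Set V) : S ⊆ convexHullSet X S :=
  fun _ hx _ hT => hT.1 hx

/-- Two opposite-angle vertices of an isometric hexagon have a common neighbour together with
the antipode of the vertex between them. -/
theorem hexagon_median (hX : IsQuasiMedian X) {o a x z y b : V} (h1 : X.Adj o a) (h2 : X.Adj a x)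
    (h3 : X.Adj x z) (h4 : X.Adj z y) (h5 : X.Adj y b) (h6 : X.Adj b o)
    (d1 : X.dist o x = 2) (d2 : X.dist a z = 2) (d3 : X.dist x y = 2) (d4 : X.dist z b = 2)
    (d5 : X.dist y o = 2) (d6 : X.dist b a = 2) (d7 : X.dist o z = 3) (d8 : X.dist a y = 3)
    (d9 : X.dist x b = 3) : ∃ w, X.Adj w x ∧ X.Adj w y ∧ X.Adj w o := by
  have hadj : ∀ i j, C6.Adj i j → X.Adj (![o, a, x, z, y, b] i) (![o, a, x, z, y, b] j) := by
    intro i j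
    rw [c6_adj]
    have := h1.symm; have := h2.symm; have := h3.symm
    have := h4.symm; have := h5.symm; have := h6.symm
    fin_cases i <;> fin_cases j <;> simp_all
  have hdist : ∀ i j, X.dist (![o, a, x, z, y, b] i) (![o, a, x, z, y, b] j) = C6.dist i j := by
    intro i j
    have e1 := dist_le_one_of_adj h1; have e2 := dist_le_one_of_adj h2
    have e3 := dist_le_one_of_adj h3; have e4 := dist_le_one_of_adj h4
    have e5 := dist_le_one_of_adj h5; have e6 := dist_le_one_of_adj h6
    rw [c6_dist]
    have s1 := e1; have s2 := e2; have s3 := e3; have s4 := e4; have s5 := e5; have s6 := e6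
    have t1 := d1; have t2 := d2; have t3 := d3; have t4 := d4; have t5 := d5; have t6 := d6
    have t7 := d7; have t8 := d8; have t9 := d9
    rw [X.dist_comm] at s1 s2 s3 s4 s5 s6 t1 t2 t3 t4 t5 t6 t7 t8 t9
    fin_cases i <;> fin_cases j <;>
      first
      | exact (X.dist_self).trans (by decide)
      | assumption
  obtain ⟨φ⟩ := hX.hullOfC6IsCube _ hadj hdist
  have hm : ∀ i, ![o, a, x, z, y, b] i ∈ convexHullSet X (Set.range ![o, a, x, z, y, b]) :=
    fun i => subset_convexHullSet _ ⟨i, rfl⟩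
  set S := convexHullSet X (Set.range ![o, a, x, z, y, b])
  have ho : o ∈ S := hm 0
  have hx : x ∈ S := hm 2
  have hz : z ∈ S := hm 3
  have hy : y ∈ S := hm 4
  have had : ∀ (u v : S), cubeGraph.Adj (φ u) (φ v) ↔ X.Adj u.1 v.1 := fun u v => φ.map_adj_iff
  have hnd : ∀ {u v : V}, 2 ≤ X.dist u v → ¬ X.Adj u v := by
    intro u v h h'
    have := dist_le_one_of_adj h'
    omega
  have hne : ∀ {u v : V} (hu : u ∈ S) (hv : v ∈ S), 2 ≤ X.dist u v → φ ⟨u, hu⟩ ≠ φ ⟨v, hv⟩ := by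
    intro u v hu hv h h'
    have := congrArg Subtype.val (φ.injective h')
    simp only at this
    subst this
    simp at h
  rw [X.dist_comm] at d5
  obtain ⟨w, hw1, hw2, hw3⟩ := cube_median (z := φ ⟨z, hz⟩) (x := φ ⟨x, hx⟩) (y := φ ⟨y, hy⟩)
    (o := φ ⟨o, ho⟩) ((had _ _).2 h3.symm) ((had _ _).2 h4) (hne _ _ (by omega))
    (hne _ _ (by omega)) (hne _ _ (by omega)) (hne _ _ (by omega))
    (fun h => hnd d1.ge ((had _ _).1 h)) (fun h => hnd d5.ge ((had _ _).1 h))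
    (fun h => hnd (by omega : 2 ≤ X.dist o z) ((had _ _).1 h))
  obtain ⟨w, rfl⟩ := φ.surjective w
  exact ⟨w, (had _ _).1 hw1, (had _ _).1 hw2, (had _ _).1 hw3⟩

theorem not_dist_two_across (hX : IsQuasiMedian X) {o x z y b : V} (hzx : X.Adj z x)
    (hzy : X.Adj z y) (hyb : X.Adj y b) (hbo : X.Adj b o) (hz : X.dist o z = 3)
    (hx : X.dist o x = 2) (hbx : X.dist b x = 2) : False := by
  have hc := hX.connected
  have e1 := dist_adj_le hc b hzy
  have e2 := dist_adj_le hc z hbo.symm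
  have e3 := dist_le_one_of_adj hyb
  rw [X.dist_comm, X.dist_comm (u := z)] at e2
  rw [X.dist_comm] at e3
  obtain ⟨t, hxt, hzt, ht⟩ := tc hX hzx.symm (o := b) (by omega)
  have hbt : X.Adj b t := SimpleGraph.dist_eq_one_iff_adj.1 (by omega)
  have f1 := dist_adj_le hc o hzt
  have f2 := dist_adj_le hc o hbt.symm
  have f3 := dist_le_one_of_adj hbo.symm
  obtain ⟨s, hts, hxs, hs⟩ := tc hX hxt.symm (o := o) (by omega)
  have hsz : s ≠ z := by
    rintro rfl
    omega
  have := k112 hX hxt hxs hzx.symm hts hzt.symm hsz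
  have := dist_adj_le hc o this.symm
  omega

theorem qc (hX : IsQuasiMedian X) {o x y z : V} (hzx : X.Adj z x) (hzy : X.Adj z y)
    (hxy : x ≠ y) (hn : ¬ X.Adj x y) (h1 : X.dist o x + 1 = X.dist o z)
    (h2 : X.dist o y + 1 = X.dist o z) :
    ∃ w, X.Adj w x ∧ X.Adj w y ∧ X.dist o w + 1 = X.dist o x := by
  have hc := hX.connected
  obtain ⟨k, o', x', y', ⟨g1, g2, g3, g4, g5, g6⟩, -⟩ := exists_quasiMedian hX o x y
  have hd := dist_eq_two hc hzx hzy hxy hn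
  simp only [OnGeod] at g1 g2 g3
  have e1 := X.dist_comm (u := x) (v := x')
  have e2 := X.dist_comm (u := y) (v := y')
  have e3 := X.dist_comm (u := o') (v := x')
  have e4 := X.dist_comm (u := o') (v := y')
  obtain rfl | rfl : k = 0 ∨ k = 2 := by omega
  · have hx : o' = x' := hc.dist_eq_zero_iff.1 (by omega)
    have hy : o' = y' := hc.dist_eq_zero_iff.1 (by omega)
    subst hx hy
    exact ⟨o', SimpleGraph.dist_eq_one_iff_adj.1 (by omega),
      SimpleGraph.dist_eq_one_iff_adj.1 (by omega), by omega⟩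
  · have hx : x = x' := hc.dist_eq_zero_iff.1 (by omega)
    have hy : y = y' := hc.dist_eq_zero_iff.1 (by omega)
    subst hx hy
    have hz := hc.dist_triangle (u := o) (v := o') (w := z)
    have hz' := dist_adj_le hc o' hzx
    suffices ∃ w, X.Adj w x ∧ X.Adj w y ∧ X.Adj w o' by
      obtain ⟨w, w1, w2, w3⟩ := this
      have := dist_adj_le hc o w3
      have := dist_adj_le hc o w1.symm
      exact ⟨w, w1, w2, by omega⟩
    by_contra hno
    obtain ⟨a, oa, xa⟩ := exists_adj_of_dist_eq_two hc g4
    obtain ⟨b, ob, yb⟩ := exists_adj_of_dist_eq_two hc g5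
    have hax : ∀ {x y a b : V}, X.Adj z x → X.Adj z y → X.dist o' x = 2 → X.dist x y = 2 →
        X.Adj x a → X.Adj y b → X.Adj o' a → X.Adj o' b → X.dist o' z = 3 →
        (¬ ∃ w, X.Adj w x ∧ X.Adj w y ∧ X.Adj w o') → X.dist x b = 3 := by
      intro x y a b zx zy ox xy xa yb oa ob oz hno
      have f1 := dist_adj_le hc x ob.symm
      rw [X.dist_comm (u := x) (v := o')] at f1
      have f2 : X.dist x b ≠ 0 := by
        intro h
        rw [hc.dist_eq_zero_iff] at h
        subst h
        have := dist_le_one_of_adj ob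
        omega
      have f3 : X.dist x b ≠ 1 := by
        intro h
        rw [SimpleGraph.dist_eq_one_iff_adj] at h
        exact hno ⟨b, h.symm, yb.symm, ob.symm⟩
      have f4 : X.dist x b ≠ 2 := by
        intro h
        rw [X.dist_comm] at h
        exact not_dist_two_across hX zx zy yb ob.symm oz ox h
      omega
    have hxb := hax hzx hzy (by omega) hd xa yb oa ob (by omega) hno
    have hya := hax hzy hzx (by omega) (by rw [X.dist_comm]; exact hd) yb xa ob oa (by omega)
      (fun ⟨w, w1, w2, w3⟩ => hno ⟨w, w2, w1, w3⟩)
    refine hno (hexagon_median hX oa xa.symm hzx.symm hzy yb ob.symm (by omega) ?_ hd ?_ (by omega)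
      ?_ (by omega) (by rw [X.dist_comm]; exact hya) hxb)
    · have := dist_adj_le hc a hzx
      have := dist_le_one_of_adj xa.symm
      have f3 := hc.dist_triangle (u := o') (v := a) (w := z)
      rw [dist_le_one_of_adj oa] at f3
      omega
    · have := dist_adj_le hc b hzy
      have := dist_le_one_of_adj yb.symm
      have f3 := hc.dist_triangle (u := o') (v := b) (w := z)
      rw [dist_le_one_of_adj ob] at f3
      rw [X.dist_comm]
      omega
    · have := dist_adj_le hc b oa.symm
      have := dist_le_one_of_adj ob.symm
      have f3 := hc.dist_triangle (u := b) (v := a) (w := x)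
      rw [dist_le_one_of_adj xa.symm, X.dist_comm (v := x)] at f3
      omega

end Quadrangle

end QM

namespace QM

section Parallelism

variable {V : Type*} {X : SimpleGraph V}

/-- The difference of the distances from `v` to `a` and to `b`. -/
noncomputable def distDiff (X : SimpleGraph V) (a b v : V) : ℤ := (X.dist v a : ℤ) - X.dist v b

theorem eqvGen_of_opposite (hX : IsQuasiMedian X) {y y' : V} (hy : X.Adj y y') (n : ℕ) :
    ∀ {q q' : V}, X.Adj q q' →
    X.dist y q = n → X.dist y' q' = n → X.dist y q' = n + 1 → X.dist y' q = n + 1 →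
    Relation.EqvGen (SideRel X) s(y, y') s(q, q') := by
  have hc := hX.connected
  induction n with
  | zero =>
    intro q q' _ h1 h2 _ _
    rw [hc.dist_eq_zero_iff] at h1 h2
    subst h1 h2
    exact Relation.EqvGen.refl _
  | succ n ih =>
    intro q q' hq h1 h2 h3 h4
    have hne : q ≠ y := by
      rintro rfl
      simp at h1
    obtain ⟨r, hqr, hr⟩ := exists_adj_dist hc hne
    have h5 := dist_adj_le hc y' hqr
    have h6 := dist_adj_le hc r hy.symm
    rw [X.dist_comm, X.dist_comm (u := r)] at h6
    have hrq : ¬ X.Adj r q' := by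
      intro h
      have := dist_adj_le hc y h.symm
      omega
    have hrq' : r ≠ q' := by
      rintro rfl
      omega
    obtain ⟨s, hsr, hsq, hs⟩ := qc hX (o := y') hqr hq hrq' hrq (by omega) (by omega)
    have h7 := dist_adj_le hc y hsr
    have h8 := dist_adj_le hc y hsq.symm
    have := ih hsr.symm (by omega) (by omega) (by omega) (by omega)
    refine this.trans _ _ _ (Relation.EqvGen.rel _ _ (Or.inr ⟨r, s, q, q', hsr.symm, hq,
      hqr.symm, hsq, hrq', ?_, rfl, rfl⟩))
    rintro rfl
    omega

theorem eqvGen_of_lower_equal (hX : IsQuasiMedian X) {y y' : V} (hy : X.Adj y y') {q q' : V}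
    (hq : X.Adj q q') (h1 : X.dist y' q = X.dist y q + 1) (h2 : X.dist y q' = X.dist y' q') :
    Relation.EqvGen (SideRel X) s(y, y') s(q, q') := by
  have hc := hX.connected
  have h3 := dist_adj_le hc y hq.symm
  have h4 := dist_adj_le hc y' hq
  obtain h5 | h5 : X.dist y q' = X.dist y q ∨ X.dist y q' = X.dist y q + 1 := by omega
  · obtain ⟨r, hr, hr', h6⟩ := tc hX hq h5.symm
    have h7 := dist_adj_le hc y' hr
    have h8 := dist_adj_le hc r hy.symm
    rw [X.dist_comm, X.dist_comm (u := r)] at h8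
    exact (not_two_lower hX (o := y') hq hr hr' (by omega) (by omega)).elim
  · obtain ⟨r, hr, hr', h6⟩ := tc hX (o := y') hq (by omega)
    have h7 := dist_adj_le hc y hr'
    have h8 := dist_adj_le hc y hr.symm
    have h9 : X.dist y r = X.dist y q + 1 := by
      by_contra h
      exact not_two_lower hX (o := y) hq.symm hr' hr (by omega) (by omega)
    have := eqvGen_of_opposite hX hy _ hr rfl (by omega) h9 (by omega)
    exact this.trans _ _ _ (Relation.EqvGen.rel _ _ (Or.inl ⟨q, r, q', hr, hq, hr'.symm, rfl, rfl⟩))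

theorem eqvGen_of_distDiff_ne (hX : IsQuasiMedian X) {y y' : V} (hy : X.Adj y y') {q q' : V}
    (hq : X.Adj q q') (h : distDiff X y y' q ≠ distDiff X y y' q') :
    Relation.EqvGen (SideRel X) s(y, y') s(q, q') := by
  have hc := hX.connected
  have aux : ∀ {y y' q q' : V}, X.Adj y y' → X.Adj q q' →
      X.dist y' q = X.dist y q + 1 → X.dist y q' ≥ X.dist y' q' →
      Relation.EqvGen (SideRel X) s(y, y') s(q, q') := by
    intro y y' q q' hy hq h1 h2
    have h3 := dist_adj_le hc y hq.symm
    have h4 := dist_adj_le hc y' hq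
    obtain h5 | h5 := h2.lt_or_eq
    · exact eqvGen_of_opposite hX hy _ hq rfl (by omega) (by omega) h1
    · exact eqvGen_of_lower_equal hX hy hq h1 h5.symm
  have h1 := dist_adj_le hc q hy
  have h2 := dist_adj_le hc q hy.symm
  have h3 := dist_adj_le hc q' hy
  have h4 := dist_adj_le hc q' hy.symm
  simp only [distDiff] at h
  rw [X.dist_comm (v := y), X.dist_comm (v := y')] at h h1 h2
  rw [X.dist_comm (v := y), X.dist_comm (v := y')] at h h3 h4
  obtain ⟨ha, hb⟩ | ⟨ha, hb⟩ | ⟨ha, hb⟩ | ⟨ha, hb⟩ :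
      (X.dist y' q = X.dist y q + 1 ∧ X.dist y q' ≥ X.dist y' q') ∨
      (X.dist y q = X.dist y' q + 1 ∧ X.dist y' q' ≥ X.dist y q') ∨
      (X.dist y' q' = X.dist y q' + 1 ∧ X.dist y q ≥ X.dist y' q) ∨
      (X.dist y q' = X.dist y' q' + 1 ∧ X.dist y' q ≥ X.dist y q) := by omega
  · exact aux hy hq ha hb
  · rw [Sym2.eq_swap]
    exact aux hy.symm hq ha hb
  · rw [Sym2.eq_swap (a := q)]
    exact aux hy hq.symm ha hb
  · rw [Sym2.eq_swap, Sym2.eq_swap (a := q)]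
    exact aux hy.symm hq.symm ha hb

section Square

variable {a b c d : V}

/-- Vertices of a square whose diagonals are not edges. -/
structure IsSquare (X : SimpleGraph V) (a b d c : V) : Prop where
  ab : X.Adj a b
  cd : X.Adj c d
  ac : X.Adj a c
  bd : X.Adj b d
  nad : ¬ X.Adj a d
  nbc : ¬ X.Adj b c
  a_ne_d : a ≠ d
  b_ne_c : b ≠ c

namespace IsSquare

theorem rot (h : IsSquare X a b d c) : IsSquare X b d c a :=
  ⟨h.bd, h.ac, h.ab.symm, h.cd.symm, h.nbc, fun g => h.nad g.symm, h.b_ne_c, h.a_ne_d.symm⟩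

theorem not_low_opposite (hX : IsQuasiMedian X) (h : IsSquare X a b d c) {v : V}
    (h1 : X.dist v a = X.dist v d) (h2 : X.dist v b = X.dist v d + 1)
    (h3 : X.dist v c = X.dist v d + 1) : False := by
  obtain ⟨s, hs, hs', h4⟩ := qc hX (o := v) h.ab.symm h.bd h.a_ne_d h.nad (by omega) (by omega)
  have hc := hX.connected
  have far : ∀ {x}, X.dist v x = X.dist v d + 1 → x ≠ s ∧ ¬ X.Adj x s := by
    intro x hx
    refine ⟨?_, fun h => ?_⟩
    · rintro rfl
      omega
    · have := dist_adj_le hc v h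
      omega
  exact h.a_ne_d (k23 hX h.b_ne_c (far h2).1 (far h3).1 h.nbc (far h2).2 (far h3).2 h.ab h.ac
    hs.symm h.bd.symm h.cd.symm hs'.symm)

theorem not_high_corner (hX : IsQuasiMedian X) (h : IsSquare X a b d c) {v : V}
    (h1 : X.dist v a = X.dist v d + 1) (h2 : X.dist v b = X.dist v d)
    (h3 : X.dist v c = X.dist v d) : False := by
  obtain ⟨s, hs, hs', h4⟩ := qc hX (o := v) h.ab h.ac h.b_ne_c h.nbc (by omega) (by omega)
  have hc := hX.connected
  have hds : d ≠ s := by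
    rintro rfl
    omega
  have has : a ≠ s := by
    rintro rfl
    omega
  have hnas : ¬ X.Adj a s := by
    intro g
    have := dist_adj_le hc v g
    omega
  by_cases hd : X.Adj d s
  · exact h.nbc (k112 hX hd h.bd.symm h.cd.symm hs hs' h.b_ne_c)
  · exact h.b_ne_c (k23 hX h.a_ne_d has hds h.nad hnas hd h.ab.symm h.bd hs.symm h.ac.symm h.cd
      hs'.symm)

theorem not_low_corner (hX : IsQuasiMedian X) (n : ℕ) : ∀ (_ : IsSquare X a b d c) {v : V}
    (_ : X.dist v a = n) (_ : X.dist v b = n + 1) (_ : X.dist v c = n + 1)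
    (_ : X.dist v d = n + 1), False := by
  have hc := hX.connected
  induction n with
  | zero =>
    intro h v h1 _ _ h4
    rw [hc.dist_eq_zero_iff] at h1
    subst h1
    exact h.nad (SimpleGraph.dist_eq_one_iff_adj.1 h4)
  | succ n ih =>
    intro h v h1 h2 h3 h4
    have hne : v ≠ a := by
      rintro rfl
      simp at h1
    obtain ⟨w, hw, hw'⟩ := exists_adj_dist hc hne
    have key : ∀ x, X.dist v x ≤ X.dist w x + 1 ∧ X.dist w x ≤ X.dist v x + 1 := by
      intro x
      have e1 := dist_adj_le hc x hw
      have e2 := dist_adj_le hc x hw.symm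
      rw [X.dist_comm, X.dist_comm (u := x)] at e1 e2
      exact ⟨e1, e2⟩
    rw [X.dist_comm, X.dist_comm (u := a)] at hw'
    have g2 := (key b).1
    have g3 := (key c).1
    have g4 := key d
    have g5 := dist_adj_le hc w h.ab.symm
    have g6 := dist_adj_le hc w h.ac.symm
    have g7 := dist_adj_le hc w h.bd.symm
    obtain g8 | g8 : X.dist w d = n + 1 ∨ X.dist w d = n + 2 := by omega
    · exact ih h (by omega) (by omega) (by omega) g8
    · obtain ⟨r, hr, hr', e⟩ := tc hX (o := d) hw (by rw [X.dist_comm, X.dist_comm (u := d)]; omega)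
      rw [X.dist_comm, X.dist_comm (u := d)] at e
      have kv : ∀ x, X.dist v x ≤ X.dist r x + 1 ∧ X.dist r x ≤ X.dist w x + 1 ∧
          X.dist r x ≤ X.dist v x + 1 := by
        intro x
        have e1 := dist_adj_le hc x hr
        have e2 := dist_adj_le hc x hr'.symm
        have e3 := dist_adj_le hc x hr.symm
        rw [X.dist_comm, X.dist_comm (u := x)] at e1 e2 e3
        exact ⟨e1, e2, e3⟩
      have up : ∀ x, X.Adj x d → X.dist v x = n + 2 → X.dist w x = n + 1 →
          X.dist r x = n + 2 := by
        intro x hx e1 e2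
        by_contra hne
        have e3 := dist_adj_le hc r hx
        refine not_two_lower hX (o := x) hw hr hr' ?_ ?_ <;>
          rw [X.dist_comm, X.dist_comm (u := x)] <;> have := kv x <;> omega
      have rb := up b h.bd (by omega) (by omega)
      have rc := up c h.cd (by omega) (by omega)
      have ka := kv a
      have f1 := dist_adj_le hc r h.ab.symm
      exact h.not_low_opposite hX (v := r) (by omega) (by omega) (by omega)

theorem dist_add (hX : IsQuasiMedian X) (h : IsSquare X a b d c) (v : V) :
    X.dist v a + X.dist v d = X.dist v b + X.dist v c := by
  have hc := hX.connected
  have e1 := dist_adj_le hc v h.ab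
  have e2 := dist_adj_le hc v h.ab.symm
  have e3 := dist_adj_le hc v h.ac
  have e4 := dist_adj_le hc v h.ac.symm
  have e5 := dist_adj_le hc v h.bd
  have e6 := dist_adj_le hc v h.bd.symm
  have e7 := dist_adj_le hc v h.cd
  have e8 := dist_adj_le hc v h.cd.symm
  have r1 := h.rot
  have r2 := r1.rot
  have r3 := r2.rot
  by_contra hne
  have n1 := fun v => h.not_low_opposite hX (v := v)
  have n2 := fun v => r1.not_low_opposite hX (v := v)
  have n3 := fun v => h.not_high_corner hX (v := v)
  have n4 := fun v => r1.not_high_corner hX (v := v)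
  have n5 := fun v => r2.not_high_corner hX (v := v)
  have n6 := fun v => r3.not_high_corner hX (v := v)
  have n7 := fun v => not_low_corner hX _ h (v := v) rfl
  have n8 := fun v => not_low_corner hX _ r1 (v := v) rfl
  have n9 := fun v => not_low_corner hX _ r2 (v := v) rfl
  have n0 := fun v => not_low_corner hX _ r3 (v := v) rfl
  rcases (by omega : X.dist v a = X.dist v b ∨ X.dist v a = X.dist v b + 1 ∨
      X.dist v b = X.dist v a + 1) with f1 | f1 | f1 <;>
    rcases (by omega : X.dist v a = X.dist v c ∨ X.dist v a = X.dist v c + 1 ∨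
      X.dist v c = X.dist v a + 1) with f2 | f2 | f2 <;>
    rcases (by omega : X.dist v d = X.dist v b ∨ X.dist v d = X.dist v b + 1 ∨
      X.dist v b = X.dist v d + 1) with f3 | f3 | f3 <;> clear e1 e2 e3 e4 e5 e6 <;>
    first
    | omega
    | exact n1 v (by omega) (by omega) (by omega)
    | exact n2 v (by omega) (by omega) (by omega)
    | exact n3 v (by omega) (by omega) (by omega)
    | exact n4 v (by omega) (by omega) (by omega)
    | exact n5 v (by omega) (by omega) (by omega)
    | exact n6 v (by omega) (by omega) (by omega)
    | exact n7 v (by omega) (by omega) (by omega)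
    | exact n8 v (by omega) (by omega) (by omega)
    | exact n9 v (by omega) (by omega) (by omega)
    | exact n0 v (by omega) (by omega) (by omega)

end IsSquare

end Square

end Parallelism

end QM

namespace QM

section Sectors

variable {V : Type*} {X : SimpleGraph V}

/-- The vertices equal or adjacent to both endpoints of an edge. -/
def edgeClique (X : SimpleGraph V) (e : Sym2 V) : Set V := {x | ∀ z ∈ e, x = z ∨ X.Adj x z}

theorem mem_edgeClique {a b x : V} :
    x ∈ edgeClique X s(a, b) ↔ (x = a ∨ X.Adj x a) ∧ (x = b ∨ X.Adj x b) := by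
  simp [edgeClique]

theorem edgeClique_adj (hX : IsQuasiMedian X) {a b x y : V} (hab : X.Adj a b)
    (hx : x ∈ edgeClique X s(a, b)) (hy : y ∈ edgeClique X s(a, b)) (hxy : x ≠ y) : X.Adj x y := by
  rw [mem_edgeClique] at hx hy
  obtain ⟨hxa, hxb⟩ := hx
  obtain ⟨hya, hyb⟩ := hy
  rcases hxa with rfl | hxa
  · exact (hya.resolve_left hxy.symm).symm
  rcases hxb with rfl | hxb
  · exact (hyb.resolve_left hxy.symm).symm
  rcases hya with rfl | hya
  · exact hxa
  rcases hyb with rfl | hyb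
  · exact hxb
  exact k112 hX hab hxa.symm hya.symm hxb.symm hyb.symm hxy

theorem edgeClique_triangle_subset (hX : IsQuasiMedian X) {a b c : V} (hab : X.Adj a b)
    (hac : X.Adj a c) (hbc : X.Adj b c) :
    edgeClique X s(a, b) ⊆ edgeClique X s(a, c) := by
  intro x hx
  have hx' := hx
  rw [mem_edgeClique] at hx ⊢
  refine ⟨hx.1, ?_⟩
  by_cases h : x = c
  · exact Or.inl h
  · exact Or.inr (edgeClique_adj hX hab hx' (mem_edgeClique.2 ⟨Or.inr hac.symm, Or.inr hbc.symm⟩) h)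

/-- The edge `e` distinguishes `v` from `w`: the gates of `v` and `w` in the clique of `e` differ. -/
def Cuts (X : SimpleGraph V) (e : Sym2 V) (v w : V) : Prop :=
  ∃ x ∈ edgeClique X e, ∃ y ∈ edgeClique X e, distDiff X x y v ≠ distDiff X x y w

theorem Cuts.of_triangle (hX : IsQuasiMedian X) {a b c v w : V} (hab : X.Adj a b)
    (hac : X.Adj a c) (hbc : X.Adj b c) (h : Cuts X s(a, b) v w) : Cuts X s(a, c) v w := by
  obtain ⟨x, hx, y, hy, hxy⟩ := h
  have := edgeClique_triangle_subset hX hab hac hbc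
  exact ⟨x, this hx, y, this hy, hxy⟩

theorem Cuts.of_isSquare (hX : IsQuasiMedian X) {a b c d v w : V} (hs : IsSquare X a b d c)
    (h : Cuts X s(a, b) v w) : Cuts X s(c, d) v w := by
  have hc := hX.connected
  obtain ⟨x, hx, y, hy, hxy⟩ := h
  have ha : a ∈ edgeClique X s(a, b) := mem_edgeClique.2 ⟨Or.inl rfl, Or.inr hs.ab⟩
  have hb : b ∈ edgeClique X s(a, b) := mem_edgeClique.2 ⟨Or.inr hs.ab.symm, Or.inl rfl⟩
  have far : ∀ x ∈ edgeClique X s(a, b), x ≠ a → x ≠ b → ¬ X.Adj x c ∧ ¬ X.Adj x d := by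
    intro x hx hxa hxb
    have h1 := edgeClique_adj hX hs.ab hx ha hxa
    have h2 := edgeClique_adj hX hs.ab hx hb hxb
    exact ⟨fun h3 => hs.nbc (k112 hX h1.symm hs.ab hs.ac h2 h3 hs.b_ne_c),
      fun h3 => hs.nad (k112 hX h2.symm hs.ab.symm hs.bd h1 h3 hs.a_ne_d)⟩
  have disj : ∀ u, u ∈ edgeClique X s(a, b) → u ∉ edgeClique X s(c, d) := by
    intro u hu hu'
    rw [mem_edgeClique] at hu'
    by_cases hua : u = a
    · subst hua
      exact hu'.2.elim hs.a_ne_d hs.nad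
    by_cases hub : u = b
    · subst hub
      exact hu'.1.elim hs.b_ne_c hs.nbc
    obtain ⟨n1, n2⟩ := far u hu hua hub
    rcases hu'.1 with rfl | h
    · rcases (mem_edgeClique.1 hu).2 with rfl | h
      · exact hub rfl
      · exact hs.nbc h.symm
    · exact n1 h
  have push : ∀ x ∈ edgeClique X s(a, b), ∃ x' ∈ edgeClique X s(c, d), X.Adj x x' := by
    intro x hx
    by_cases hxa : x = a
    · subst hxa
      exact ⟨c, mem_edgeClique.2 ⟨Or.inl rfl, Or.inr hs.cd⟩, hs.ac⟩
    by_cases hxb : x = b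
    · subst hxb
      exact ⟨d, mem_edgeClique.2 ⟨Or.inr hs.cd.symm, Or.inl rfl⟩, hs.bd⟩
    have h1 := edgeClique_adj hX hs.ab hx ha hxa
    have h2 := edgeClique_adj hX hs.ab hx hb hxb
    obtain ⟨n1, n2⟩ := far x hx hxa hxb
    have hxc : x ≠ c := by
      rintro rfl
      exact hs.nbc h2.symm
    have hxd : x ≠ d := by
      rintro rfl
      exact hs.nad h1.symm
    have e1 := dist_eq_two hc h1.symm hs.ac hxc n1
    have e2 := dist_eq_two hc h2.symm hs.bd hxd n2
    obtain ⟨x', g1, g2, g3⟩ := tc hX hs.cd (e1.trans e2.symm)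
    exact ⟨x', mem_edgeClique.2 ⟨Or.inr g1.symm, Or.inr g2.symm⟩,
      SimpleGraph.dist_eq_one_iff_adj.1 (by omega)⟩
  have inj : ∀ x ∈ edgeClique X s(a, b), ∀ y ∈ edgeClique X s(a, b), x ≠ y →
      ∀ u ∈ edgeClique X s(c, d), X.Adj x u → ¬ X.Adj y u := by
    intro x hx y hy hxy u hu hxu hyu
    have hadj := edgeClique_adj hX hs.ab hx hy hxy
    have key : ∀ z ∈ edgeClique X s(a, b), u = z ∨ X.Adj u z := by
      intro z hz
      by_cases huz : u = z
      · exact Or.inl huz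
      by_cases hzx : z = x
      · subst hzx
        exact Or.inr hxu.symm
      by_cases hzy : z = y
      · subst hzy
        exact Or.inr hyu.symm
      exact Or.inr (k112 hX hadj hxu (edgeClique_adj hX hs.ab hx hz (Ne.symm hzx)) hyu
        (edgeClique_adj hX hs.ab hy hz (Ne.symm hzy)) huz)
    exact disj u (mem_edgeClique.2 ⟨key a ha, key b hb⟩) hu
  have hne : x ≠ y := by
    rintro rfl
    exact hxy (by simp [distDiff])
  obtain ⟨x', hx', hxx'⟩ := push x hx
  obtain ⟨y', hy', hyy'⟩ := push y hy
  have hsq : IsSquare X x y y' x' :=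
    ⟨edgeClique_adj hX hs.ab hx hy hne,
      edgeClique_adj hX hs.cd hx' hy' (fun h => inj x hx y hy hne x' hx' hxx' (h ▸ hyy')),
      hxx', hyy', inj y hy x hx hne.symm y' hy' hyy', inj x hx y hy hne x' hx' hxx',
      fun h => disj x hx (h ▸ hy'), fun h => disj y hy (h ▸ hx')⟩
  refine ⟨x', hx', y', hy', ?_⟩
  have e1 := hsq.dist_add hX v
  have e2 := hsq.dist_add hX w
  simp only [distDiff] at hxy ⊢
  omega

theorem Cuts.of_square (hX : IsQuasiMedian X) {a b c d v w : V} (hab : X.Adj a b)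
    (hcd : X.Adj c d) (hac : X.Adj a c) (hbd : X.Adj b d) (had : a ≠ d) (hbc : b ≠ c)
    (h : Cuts X s(a, b) v w) : Cuts X s(c, d) v w := by
  by_cases h1 : X.Adj a d
  · have h2 := k112 hX h1 hab hac hbd.symm hcd.symm hbc
    have := h.of_triangle hX hab hac h2
    rw [Sym2.eq_swap] at this
    exact this.of_triangle hX hac.symm hcd h1
  by_cases h2 : X.Adj b c
  · have h3 := k112 hX h2 hab.symm hbd hac.symm hcd had
    exact (h1 h3).elim
  exact h.of_isSquare hX ⟨hab, hcd, hac, hbd, h1, h2, had, hbc⟩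

theorem cuts_iff_of_sideRel (hX : IsQuasiMedian X) {e f : Sym2 V} (h : SideRel X e f) (v w : V) :
    Cuts X e v w ↔ Cuts X f v w := by
  rcases h with ⟨a, b, c, hab, hac, hbc, rfl, rfl⟩ | ⟨a, b, c, d, hab, hcd, hac, hbd, had, hbc, rfl, rfl⟩
  · exact ⟨fun h => h.of_triangle hX hab hac hbc, fun h => h.of_triangle hX hac hab hbc.symm⟩
  · exact ⟨fun h => h.of_square hX hab hcd hac hbd had hbc,
      fun h => h.of_square hX hcd hab hac.symm hbd.symm hbc.symm had.symm⟩

theorem cuts_iff_of_eqvGen (hX : IsQuasiMedian X) {e f : Sym2 V}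
    (h : Relation.EqvGen (SideRel X) e f) (v w : V) : Cuts X e v w ↔ Cuts X f v w := by
  induction h with
  | rel _ _ h => exact cuts_iff_of_sideRel hX h v w
  | refl => exact Iff.rfl
  | symm _ _ _ ih => exact ih.symm
  | trans _ _ _ _ _ ih1 ih2 => exact ih1.trans ih2

/-- The edge between `a` and `b` is dual to `H`. -/
def Dual (H : Hyperplane X) (a b : V) : Prop := s(a, b) ∈ H.1

theorem Dual.symm {H : Hyperplane X} {a b : V} (h : Dual H a b) : Dual H b a := by
  unfold Dual at *
  rwa [Sym2.eq_swap]

theorem mem_edgeSet_of_eqvGen {e f : Sym2 V} (h : Relation.EqvGen (SideRel X) e f) :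
    e ∈ X.edgeSet ↔ f ∈ X.edgeSet := by
  induction h with
  | rel _ _ h =>
    rcases h with ⟨a, b, c, hab, hac, hbc, rfl, rfl⟩ |
      ⟨a, b, c, d, hab, hcd, hac, hbd, had, hbc, rfl, rfl⟩
    · simp [hab, hac]
    · simp [hab, hcd]
  | refl => exact Iff.rfl
  | symm _ _ _ ih => exact ih.symm
  | trans _ _ _ _ _ ih1 ih2 => exact ih1.trans ih2

theorem mem_hyperplane_iff (H : Hyperplane X) {e f : Sym2 V} (he : e ∈ H.1) :
    f ∈ H.1 ↔ Relation.EqvGen (SideRel X) e f := by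
  obtain ⟨H, e', he', rfl⟩ := H
  simp only [hypClass, Set.mem_ofPred_eq] at *
  exact ⟨fun h => (he.symm _ _).trans _ _ _ h, fun h => he.trans _ _ _ h⟩

theorem Dual.adj {H : Hyperplane X} {a b : V} (h : Dual H a b) : X.Adj a b := by
  obtain ⟨H, e', he', rfl⟩ := H
  exact (mem_edgeSet_of_eqvGen h).1 he'

theorem exists_dual {a b : V} (h : X.Adj a b) : ∃ H : Hyperplane X, Dual H a b :=
  ⟨⟨hypClass X s(a, b), s(a, b), h, rfl⟩, Relation.EqvGen.refl _⟩

theorem hyperplane_ext_of_mem {H K : Hyperplane X} {e : Sym2 V} (h1 : e ∈ H.1) (h2 : e ∈ K.1) :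
    H = K := by
  apply Subtype.ext
  ext f
  rw [mem_hyperplane_iff H h1, mem_hyperplane_iff K h2]

theorem Dual.unique {H K : Hyperplane X} {a b : V} (h : Dual H a b) (h' : Dual K a b) : H = K :=
  hyperplane_ext_of_mem h h'

theorem Dual.of_triangle {H : Hyperplane X} {a b c : V} (h : Dual H a b) (hac : X.Adj a c)
    (hbc : X.Adj b c) : Dual H a c :=
  (mem_hyperplane_iff H h).2 (Relation.EqvGen.rel _ _ (Or.inl ⟨a, b, c, h.adj, hac, hbc, rfl, rfl⟩))

theorem Dual.of_square {H : Hyperplane X} {a b c d : V} (h : Dual H a b) (hcd : X.Adj c d)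
    (hac : X.Adj a c) (hbd : X.Adj b d) (had : a ≠ d) (hbc : b ≠ c) : Dual H c d :=
  (mem_hyperplane_iff H h).2
    (Relation.EqvGen.rel _ _ (Or.inr ⟨a, b, c, d, h.adj, hcd, hac, hbd, had, hbc, rfl, rfl⟩))

/-- `v` and `w` lie in the same sector of `H`. -/
def SameSector (H : Hyperplane X) (v w : V) : Prop :=
  ∀ a b, Dual H a b → distDiff X a b v = distDiff X a b w

theorem SameSector.refl (H : Hyperplane X) (v : V) : SameSector H v v := fun _ _ _ => rfl

theorem SameSector.symm {H : Hyperplane X} {v w : V} (h : SameSector H v w) : SameSector H w v :=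
  fun a b hab => (h a b hab).symm

theorem SameSector.trans {H : Hyperplane X} {v w u : V} (h : SameSector H v w)
    (h' : SameSector H w u) : SameSector H v u :=
  fun a b hab => (h a b hab).trans (h' a b hab)

theorem sameSector_iff (hX : IsQuasiMedian X) {H : Hyperplane X} {a b v w : V} (h : Dual H a b) :
    SameSector H v w ↔ ¬ Cuts X s(a, b) v w := by
  constructor
  · rintro hs ⟨x, hx, y, hy, hxy⟩
    apply hxy
    by_cases hne : x = y
    · subst hne
      simp [distDiff]
    apply hs
    have hadj := edgeClique_adj hX h.adj hx hy hne
    have ha : a ∈ edgeClique X s(a, b) := mem_edgeClique.2 ⟨Or.inl rfl, Or.inr h.adj⟩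
    have hb : b ∈ edgeClique X s(a, b) := mem_edgeClique.2 ⟨Or.inr h.adj.symm, Or.inl rfl⟩
    have step : ∀ {x}, x ∈ edgeClique X s(a, b) → x ≠ a → Dual H a x := by
      intro x hx hxa
      by_cases hxb : x = b
      · exact hxb ▸ h
      · exact h.of_triangle (edgeClique_adj hX h.adj ha hx (Ne.symm hxa))
          (edgeClique_adj hX h.adj hb hx (Ne.symm hxb))
    by_cases hxa : x = a
    · subst hxa
      exact step hy (Ne.symm hne)
    by_cases hya : y = a
    · subst hya
      exact (step hx hne).symm
    exact (step hx hxa).symm.of_triangle hadj (edgeClique_adj hX h.adj ha hy (Ne.symm hya))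
  · intro hn c d hcd
    by_contra hne
    apply hn
    rw [← cuts_iff_of_eqvGen hX ((mem_hyperplane_iff H hcd).1 h)]
    exact ⟨c, mem_edgeClique.2 ⟨Or.inl rfl, Or.inr hcd.adj⟩, d,
      mem_edgeClique.2 ⟨Or.inr hcd.adj.symm, Or.inl rfl⟩, hne⟩

theorem Dual.not_sameSector {H : Hyperplane X} {a b : V} (h : Dual H a b) :
    ¬ SameSector H a b := by
  intro hs
  have := hs a b h
  have e := dist_le_one_of_adj h.adj
  have e' := dist_le_one_of_adj h.adj.symm
  simp [distDiff, e, e'] at this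

theorem sameSector_of_adj (hX : IsQuasiMedian X) {H : Hyperplane X} {a b : V} (hab : X.Adj a b)
    (h : ¬ Dual H a b) : SameSector H a b := by
  intro c d hcd
  by_contra hne
  exact h ((mem_hyperplane_iff H hcd).2 (eqvGen_of_distDiff_ne hX hcd.adj hab hne))

theorem Dual.sameSector_of_dist_lt (hX : IsQuasiMedian X) {H : Hyperplane X} {a b v : V}
    (h : Dual H a b) (hlt : X.dist v b < X.dist v a) : SameSector H b v := by
  have hc := hX.connected
  rw [sameSector_iff hX h]
  rintro ⟨x, hx, y, hy, hxy⟩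
  have ha : a ∈ edgeClique X s(a, b) := mem_edgeClique.2 ⟨Or.inl rfl, Or.inr h.adj⟩
  have hb : b ∈ edgeClique X s(a, b) := mem_edgeClique.2 ⟨Or.inr h.adj.symm, Or.inl rfl⟩
  have e1 := dist_adj_le hc v h.adj
  have key : ∀ x ∈ edgeClique X s(a, b), X.dist v x = X.dist v b + X.dist b x := by
    intro x hx
    by_cases hxb : x = b
    · subst hxb
      simp
    have hbx := edgeClique_adj hX h.adj hx hb hxb
    rw [dist_le_one_of_adj hbx.symm]
    by_cases hxa : x = a
    · subst hxa
      omega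
    have hax := edgeClique_adj hX h.adj hx ha hxa
    have e2 := dist_adj_le hc v hbx
    have e3 := dist_adj_le hc v hbx.symm
    have e4 := dist_adj_le hc v hax.symm
    by_contra hne
    exact not_two_lower hX (o := v) h.adj hax.symm hbx.symm (by omega) (by omega)
  have := key x hx
  have := key y hy
  simp only [distDiff] at hxy
  omega

theorem Dual.adj_of_ne (hX : IsQuasiMedian X) {H : Hyperplane X} {y z t : V} (h : Dual H y z)
    (h' : Dual H y t) (hne : z ≠ t) : X.Adj z t := by
  by_contra hn
  have hd := dist_eq_two hX.connected h.adj h'.adj hne hn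
  refine h'.not_sameSector (h.symm.sameSector_of_dist_lt hX ?_)
  rw [X.dist_comm (v := z), hd, dist_le_one_of_adj h'.adj.symm]
  norm_num

/-- `w` lies on a geodesic from `v` to `q`. -/
def Toward (X : SimpleGraph V) (q v w : V) : Prop := X.dist v w + X.dist w q = X.dist v q

theorem Toward.refl (q v : V) : Toward X q v v := by simp [Toward]

theorem Toward.trans (hc : X.Connected) {q v w u : V} (h : Toward X q v w)
    (h' : Toward X q w u) : Toward X q v u ∧ Toward X u v w := by
  have e1 := hc.dist_triangle (u := v) (v := w) (w := u)
  have e2 := hc.dist_triangle (u := v) (v := u) (w := q)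
  simp only [Toward] at *
  omega

theorem Toward.left (hc : X.Connected) {q v w u : V} (h : Toward X q v u)
    (h' : Toward X u v w) : Toward X q v w ∧ Toward X q w u := by
  have e1 := hc.dist_triangle (u := v) (v := w) (w := q)
  have e2 := hc.dist_triangle (u := w) (v := u) (w := q)
  simp only [Toward] at *
  omega

theorem Toward.exists_first (hc : X.Connected) {q v w : V} (h : Toward X q v w) (hne : v ≠ w) :
    ∃ z, X.Adj v z ∧ X.dist w z + 1 = X.dist w v ∧ X.dist z q + 1 = X.dist v q ∧
      Toward X q z w := by
  obtain ⟨z, hz, e⟩ := exists_adj_dist hc hne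
  have e1 := dist_adj_le hc q hz
  have e2 := hc.dist_triangle (u := z) (v := w) (w := q)
  rw [X.dist_comm, X.dist_comm (u := w)] at e
  rw [X.dist_comm, X.dist_comm (u := q)] at e1
  refine ⟨z, hz, ?_⟩
  rw [X.dist_comm, X.dist_comm (u := w)]
  simp only [Toward] at *
  omega

theorem Toward.exists_last (hc : X.Connected) {q v w : V} (h : Toward X q v w) (hne : v ≠ w) :
    ∃ z, X.Adj z w ∧ X.dist v z + 1 = X.dist v w ∧ X.dist w q + 1 = X.dist z q ∧
      Toward X q v z := by
  obtain ⟨z, hz, e⟩ := exists_adj_dist hc hne.symm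
  have e1 := dist_adj_le hc q hz.symm
  have e2 := hc.dist_triangle (u := v) (v := z) (w := q)
  rw [X.dist_comm, X.dist_comm (u := q)] at e1
  refine ⟨z, hz.symm, e, ?_⟩
  simp only [Toward] at *
  omega

theorem toward_of_adj {q v w : V} (hvw : X.Adj v w) (h : X.dist w q + 1 = X.dist v q) :
    Toward X q v w := by
  have := dist_le_one_of_adj hvw
  simp only [Toward]
  omega

theorem Toward.induction {q : V} (hc : X.Connected) {P : V → V → Prop} (h0 : ∀ v, P v v)
    (h1 : ∀ v z w, X.Adj v z → X.dist z q + 1 = X.dist v q → Toward X q z w →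
      Toward X q v w → P z w → P v w) :
    ∀ {v w : V}, Toward X q v w → P v w := by
  have key : ∀ n v w, X.dist v q = n → Toward X q v w → P v w := by
    intro n
    induction n with
    | zero =>
      intro v w e h
      by_cases hne : v = w
      · exact hne ▸ h0 v
      · obtain ⟨z, -, -, e', -⟩ := h.exists_first hc hne
        omega
    | succ n ih =>
      intro v w e h
      by_cases hne : v = w
      · exact hne ▸ h0 v
      · obtain ⟨z, hz, -, e', h'⟩ := h.exists_first hc hne
        exact h1 v z w hz e' h' h (ih z w (by omega) h')
  exact fun {v w} h => key _ v w rfl h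

theorem Toward.exists_dual (hX : IsQuasiMedian X) {q v w : V} {H : Hyperplane X}
    (h : Toward X q v w) (hs : ¬ SameSector H v w) :
    ∃ u u', Dual H u u' ∧ Toward X q v u ∧ X.dist u' q + 1 = X.dist u q ∧ Toward X q u' w := by
  have hc := hX.connected
  revert hs
  refine Toward.induction hc (P := fun v w => ¬ SameSector H v w → ∃ u u', Dual H u u' ∧
    Toward X q v u ∧ X.dist u' q + 1 = X.dist u q ∧ Toward X q u' w) ?_ ?_ h
  · intro v hn
    exact (hn (SameSector.refl H v)).elim
  · intro v z w hvz e hzw hvw ih hn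
    by_cases hd : Dual H v z
    · exact ⟨v, z, hd, Toward.refl q v, e, hzw⟩
    · have h1 := sameSector_of_adj hX hvz hd
      obtain ⟨u, u', g1, g2, g3, g4⟩ := ih (fun h2 => hn (h1.trans h2))
      exact ⟨u, u', g1, ((toward_of_adj hvz e).trans hc g2).1, g3, g4⟩

theorem Toward.sameSector_end (hX : IsQuasiMedian X) {q v w : V} {H : Hyperplane X}
    (h : Toward X q v w) (hs : ¬ SameSector H v w) : SameSector H w q ∧ ¬ SameSector H v q := by
  have hc := hX.connected
  obtain ⟨u, u', g1, g2, g3, g4⟩ := h.exists_dual hX hs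
  have h1 : SameSector H u' q := g1.sameSector_of_dist_lt hX (by
    rw [X.dist_comm, X.dist_comm (u := q)]
    omega)
  have h2 : SameSector H u' w := by
    refine g1.sameSector_of_dist_lt hX ?_
    have := hc.dist_triangle (u := u) (v := w) (w := q)
    rw [X.dist_comm, X.dist_comm (u := w)]
    simp only [Toward] at g4
    omega
  have h3 := h2.symm.trans h1
  exact ⟨h3, fun h4 => hs (h4.trans h3.symm)⟩

theorem Toward.sameSector_iff (hX : IsQuasiMedian X) {q v w u : V} {H : Hyperplane X}
    (h : Toward X q v w) (h' : Toward X q w u) :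
    SameSector H v u ↔ SameSector H v w ∧ SameSector H w u := by
  refine ⟨fun hs => ?_, fun hs => hs.1.trans hs.2⟩
  have : SameSector H v w := by
    by_contra hn
    exact ((h.trans hX.connected h').2.sameSector_end hX hn).2 hs
  exact ⟨this, this.symm.trans hs⟩

end Sectors

end QM

namespace QM

section Types

variable {V : Type*} {G : Type*} [Group G] {X : SimpleGraph V}

namespace GraphAction

variable (α : GraphAction G X)

theorem act_inv_act (g : G) (v : V) : α.act g⁻¹ (α.act g v) = v := by
  rw [← α.act_mul, inv_mul_cancel, α.act_one]

theorem act_act_inv (g : G) (v : V) : α.act g (α.act g⁻¹ v) = v := by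
  rw [← α.act_mul, mul_inv_cancel, α.act_one]

theorem act_injective (g : G) : Function.Injective (α.act g) :=
  Function.LeftInverse.injective (α.act_inv_act g)

theorem map_act_map_act (g h : G) (e : Sym2 V) :
    Sym2.map (α.act g) (Sym2.map (α.act h) e) = Sym2.map (α.act (g * h)) e := by
  rw [Sym2.map_map]
  congr 1
  ext v
  exact (α.act_mul g h v).symm

theorem map_act_one (e : Sym2 V) : Sym2.map (α.act 1) e = e := by
  have : α.act 1 = id := funext α.act_one
  rw [this, Sym2.map_id, id]

theorem sideRel_map {e f : Sym2 V} (g : G) (h : SideRel X e f) :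
    SideRel X (Sym2.map (α.act g) e) (Sym2.map (α.act g) f) := by
  rcases h with ⟨a, b, c, hab, hac, hbc, rfl, rfl⟩ |
    ⟨a, b, c, d, hab, hcd, hac, hbd, had, hbc, rfl, rfl⟩
  · exact Or.inl ⟨α.act g a, α.act g b, α.act g c, (α.act_adj _ _ _).2 hab,
      (α.act_adj _ _ _).2 hac, (α.act_adj _ _ _).2 hbc, rfl, rfl⟩
  · exact Or.inr ⟨α.act g a, α.act g b, α.act g c, α.act g d, (α.act_adj _ _ _).2 hab,
      (α.act_adj _ _ _).2 hcd, (α.act_adj _ _ _).2 hac, (α.act_adj _ _ _).2 hbd,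
      (α.act_injective g).ne had, (α.act_injective g).ne hbc, rfl, rfl⟩

theorem eqvGen_map {e f : Sym2 V} (g : G) (h : Relation.EqvGen (SideRel X) e f) :
    Relation.EqvGen (SideRel X) (Sym2.map (α.act g) e) (Sym2.map (α.act g) f) := by
  induction h with
  | rel _ _ h => exact Relation.EqvGen.rel _ _ (α.sideRel_map g h)
  | refl => exact Relation.EqvGen.refl _
  | symm _ _ _ ih => exact ih.symm
  | trans _ _ _ _ _ ih1 ih2 => exact ih1.trans _ _ _ ih2

theorem isHyperplane_hypImage (g : G) (H : Hyperplane X) : IsHyperplane X (α.hypImage g H.1) := by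
  obtain ⟨H, e, he, rfl⟩ := H
  refine ⟨Sym2.map (α.act g) e, ?_, ?_⟩
  · induction e with
    | h a b => exact (α.act_adj g a b).2 he
  · ext f
    constructor
    · rintro ⟨f, hf, rfl⟩
      exact α.eqvGen_map g hf
    · intro hf
      refine ⟨Sym2.map (α.act g⁻¹) f, ?_, ?_⟩
      · have := α.eqvGen_map g⁻¹ hf
        rwa [map_act_map_act, inv_mul_cancel, map_act_one] at this
      · rw [map_act_map_act, mul_inv_cancel, map_act_one]

/-- The translate of a hyperplane. -/
def hyp (g : G) (H : Hyperplane X) : Hyperplane X := ⟨α.hypImage g H.1, α.isHyperplane_hypImage g H⟩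

theorem hyp_mul (g h : G) (H : Hyperplane X) : α.hyp g (α.hyp h H) = α.hyp (g * h) H := by
  apply Subtype.ext
  simp only [hyp, hypImage, Set.image_image, map_act_map_act]

theorem hyp_one (H : Hyperplane X) : α.hyp 1 H = H := by
  apply Subtype.ext
  simp only [hyp, hypImage, map_act_one, Set.image_id']

theorem hyp_inv_hyp (g : G) (H : Hyperplane X) : α.hyp g⁻¹ (α.hyp g H) = H := by
  rw [hyp_mul, inv_mul_cancel, hyp_one]

theorem hyp_hyp_inv (g : G) (H : Hyperplane X) : α.hyp g (α.hyp g⁻¹ H) = H := by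
  rw [hyp_mul, mul_inv_cancel, hyp_one]

theorem dual_hyp (g : G) {H : Hyperplane X} {a b : V} (h : Dual H a b) :
    Dual (α.hyp g H) (α.act g a) (α.act g b) := ⟨s(a, b), h, rfl⟩

theorem sameOrbit_iff {H K : Hyperplane X} : SameOrbit α H K ↔ ∃ g, K = α.hyp g H :=
  ⟨fun ⟨g, h⟩ => ⟨g, Subtype.ext h⟩, fun ⟨g, h⟩ => ⟨g, congrArg Subtype.val h⟩⟩

theorem hypIntersect_hyp (g : G) {H K : Hyperplane X} (h : HypIntersect X H K) :
    HypIntersect X (α.hyp g H) (α.hyp g K) := by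
  obtain ⟨p, e, he, e', he', a, b, rfl, rfl, hpa, hpb, hab, hn, q, hq, haq, hbq⟩ := h
  refine ⟨α.act g p, _, ⟨_, he, rfl⟩, _, ⟨_, he', rfl⟩, α.act g a, α.act g b, rfl, rfl,
    (α.act_adj _ _ _).2 hpa, (α.act_adj _ _ _).2 hpb, (α.act_injective g).ne hab,
    fun h => hn ((α.act_adj _ _ _).1 h), α.act g q, (α.act_injective g).ne hq,
    (α.act_adj _ _ _).2 haq, (α.act_adj _ _ _).2 hbq⟩

theorem equivalence_sameOrbit : Equivalence (SameOrbit α) where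
  refl H := α.sameOrbit_iff.2 ⟨1, (α.hyp_one H).symm⟩
  symm := by
    intro H K h
    obtain ⟨g, rfl⟩ := α.sameOrbit_iff.1 h
    exact α.sameOrbit_iff.2 ⟨g⁻¹, (α.hyp_inv_hyp g H).symm⟩
  trans := by
    intro H K L h h'
    obtain ⟨g, rfl⟩ := α.sameOrbit_iff.1 h
    obtain ⟨g', rfl⟩ := α.sameOrbit_iff.1 h'
    exact α.sameOrbit_iff.2 ⟨g' * g, α.hyp_mul g' g H⟩

/-- The orbit of a hyperplane. -/
def type (H : Hyperplane X) : HypOrbit α := Quot.mk (SameOrbit α) H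

theorem type_eq_iff {H K : Hyperplane X} : α.type H = α.type K ↔ SameOrbit α H K := by
  refine ⟨fun h => ?_, fun h => Quot.sound h⟩
  exact (α.equivalence_sameOrbit.eqvGen_iff).1 (Quot.eqvGen_exact h)

theorem type_hyp (g : G) (H : Hyperplane X) : α.type (α.hyp g H) = α.type H :=
  (α.type_eq_iff.2 (α.sameOrbit_iff.2 ⟨g, rfl⟩)).symm

/-- Two orbits of hyperplanes have intersecting representatives. -/
def Perp (s t : HypOrbit α) : Prop :=
  ∃ H K : Hyperplane X, α.type H = s ∧ α.type K = t ∧ HypIntersect X H K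

/-- `t` lies in the star of `s`. -/
def Star (s t : HypOrbit α) : Prop := t = s ∨ α.Perp s t

end GraphAction

variable {α : GraphAction G X}

theorem hypIntersect_symm {H K : Hyperplane X} (h : HypIntersect X H K) : HypIntersect X K H := by
  obtain ⟨p, e, he, e', he', a, b, rfl, rfl, hpa, hpb, hab, hn, q, hq, haq, hbq⟩ := h
  exact ⟨p, _, he', _, he, b, a, rfl, rfl, hpb, hpa, hab.symm, fun h => hn h.symm, q, hq, hbq, haq⟩

theorem GraphAction.Perp.symm {s t : HypOrbit α} (h : α.Perp s t) : α.Perp t s := by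
  obtain ⟨H, K, hH, hK, h⟩ := h
  exact ⟨K, H, hK, hH, hypIntersect_symm h⟩

theorem GraphAction.perp_of_hypIntersect {H K : Hyperplane X} (h : HypIntersect X H K) :
    α.Perp (α.type H) (α.type K) := ⟨H, K, rfl, rfl, h⟩

theorem HypIntersect.ne (hX : IsQuasiMedian X) {H K : Hyperplane X} (h : HypIntersect X H K) :
    H ≠ K := by
  rintro rfl
  obtain ⟨p, e, he, e', he', a, b, rfl, rfl, hpa, hpb, hab, hn, -⟩ := h
  exact hn (Dual.adj_of_ne hX he he' hab)

/-- Edges at a common vertex dual to distinct hyperplanes are not in a common clique. -/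
theorem Dual.not_adj {H K : Hyperplane X} {v a b : V} (h : Dual H v a) (h' : Dual K v b)
    (hne : H ≠ K) : a ≠ b ∧ ¬ X.Adj a b := by
  refine ⟨?_, fun hab => hne ((h.of_triangle h'.adj hab).unique h')⟩
  rintro rfl
  exact hne (h.unique h')

theorem Dual.intersect_or_osculate {H K : Hyperplane X} {v a b : V} (h : Dual H v a)
    (h' : Dual K v b) (hne : H ≠ K) : HypIntersect X H K ∨ HypOsculate X H K := by
  obtain ⟨h1, h2⟩ := h.not_adj h' hne
  by_cases hq : ∃ q : V, q ≠ v ∧ X.Adj a q ∧ X.Adj b q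
  · exact Or.inl ⟨v, _, h, _, h', a, b, rfl, rfl, h.adj, h'.adj, h1, h2, hq⟩
  · exact Or.inr ⟨v, _, h, _, h', a, b, rfl, rfl, h.adj, h'.adj, h1, h2, hq⟩

theorem hypIntersect_of_square {H K : Hyperplane X} {v a b s : V} (h : Dual H v a)
    (h' : Dual K v b) (hne : H ≠ K) (hs : s ≠ v) (ha : X.Adj a s) (hb : X.Adj b s) :
    HypIntersect X H K := by
  obtain ⟨h1, h2⟩ := h.not_adj h' hne
  exact ⟨v, _, h, _, h', a, b, rfl, rfl, h.adj, h'.adj, h1, h2, s, hs, ha, hb⟩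

theorem GraphAction.type_ne_of_perp (hX : IsQuasiMedian X) (hsp : IsSpecial α)
    {H K : Hyperplane X} (h : α.Perp (α.type H) (α.type K)) : α.type H ≠ α.type K := by
  obtain ⟨H', K', hH, hK, h⟩ := h
  intro he
  rw [← hH, ← hK, α.type_eq_iff] at he
  exact hsp.1 _ _ he (HypIntersect.ne hX h) (Or.inl h)

/-- In a special action, edges with intersecting orbits at a common vertex span a square. -/
theorem GraphAction.Perp.exists_square (hX : IsQuasiMedian X) (hsp : IsSpecial α)
    {H K : Hyperplane X} {v a b : V} (h : α.Perp (α.type H) (α.type K)) (ha : Dual H v a)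
    (hb : Dual K v b) : a ≠ b ∧ ¬ X.Adj a b ∧ ∃ s, s ≠ v ∧ X.Adj a s ∧ X.Adj b s := by
  have hne : H ≠ K := fun h' => GraphAction.type_ne_of_perp hX hsp h (congrArg α.type h')
  obtain ⟨h1, h2⟩ := ha.not_adj hb hne
  refine ⟨h1, h2, ?_⟩
  by_contra hq
  obtain ⟨H', K', hH, hK, hi⟩ := h
  rw [α.type_eq_iff, α.sameOrbit_iff] at hK
  obtain ⟨g, rfl⟩ := hK
  refine hsp.2 (α.hyp g H') (α.hyp g K') H (α.hypIntersect_hyp g hi) ?_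
    ⟨v, _, ha, _, hb, a, b, rfl, rfl, ha.adj, hb.adj, h1, h2, hq⟩
  rw [← α.type_eq_iff, α.type_hyp, hH]

theorem mem_hypCarrier {A : Hyperplane X} {v : V} : v ∈ hypCarrier X A ↔ ∃ a, Dual A v a := by
  constructor
  · rintro ⟨e, he, hv⟩
    obtain ⟨a, rfl⟩ := Sym2.mem_iff_exists.1 hv
    exact ⟨a, he⟩
  · rintro ⟨a, ha⟩
    exact ⟨_, ha, Sym2.mem_mk_left _ _⟩

theorem mem_hypCarrier_of_star (hX : IsQuasiMedian X) (hsp : IsSpecial α) {A K : Hyperplane X}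
    {v z : V} (hv : v ∈ hypCarrier X A) (hz : Dual K v z) (hs : α.Star (α.type A) (α.type K)) :
    z ∈ hypCarrier X A := by
  rw [mem_hypCarrier] at *
  obtain ⟨a, ha⟩ := hv
  by_cases hAK : A = K
  · subst hAK
    exact ⟨v, hz.symm⟩
  rcases hs with hs | hs
  · exact (hsp.1 A K (α.type_eq_iff.1 hs.symm) hAK (ha.intersect_or_osculate hz hAK)).elim
  · obtain ⟨h1, -, s, h3, h4, h5⟩ := hs.exists_square hX hsp ha hz
    exact ⟨s, ha.of_square h5 hz.adj h4 h3.symm h1⟩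

theorem dual_reachable {H K : Hyperplane X} {v a b : V} (ha : Dual H v a) (hb : Dual K v b) :
    (contactGraph X).dist H K ≤ 1 ∧ (contactGraph X).Reachable H K := by
  by_cases hne : H = K
  · subst hne
    simp
  · have : (contactGraph X).Adj H K := by
      rw [contactGraph, SimpleGraph.fromRel_adj]
      exact ⟨hne, Or.inl (ha.intersect_or_osculate hb hne)⟩
    exact ⟨(dist_le_one_of_adj this).le, this.reachable⟩

theorem contactGraph_reachable {v w : V} (p : X.Walk v w) : ∀ {H K : Hyperplane X} {a b : V},
    Dual H v a → Dual K w b → (contactGraph X).Reachable H K := by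
  induction p with
  | nil => exact fun ha hb => (dual_reachable ha hb).2
  | cons h p ih =>
    intro H K a b ha hb
    obtain ⟨L, hL⟩ := exists_dual h
    exact (dual_reachable ha hL).2.trans (ih hL.symm hb)

theorem exists_dual_of_hyperplane (H : Hyperplane X) : ∃ a b, Dual H a b := by
  obtain ⟨H, e, he, rfl⟩ := H
  induction e with
  | h a b => exact ⟨a, b, Relation.EqvGen.refl _⟩

theorem contactGraph_connected (hc : X.Connected) (A : Hyperplane X) :
    (contactGraph X).Connected := by
  have : Nonempty (Hyperplane X) := ⟨A⟩
  refine ⟨fun H K => ?_⟩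
  obtain ⟨a, b, h⟩ := exists_dual_of_hyperplane H
  obtain ⟨c, d, h'⟩ := exists_dual_of_hyperplane K
  obtain ⟨p⟩ := hc.preconnected a c
  exact contactGraph_reachable p h h'

variable (α) in
/-- An edge inside the carrier of `A` whose orbit lies in the star of the orbit of `A`. -/
def StepIn (A : Hyperplane X) (v w : V) : Prop :=
  v ∈ hypCarrier X A ∧ w ∈ hypCarrier X A ∧ ∃ K, Dual K v w ∧ α.Star (α.type A) (α.type K)

theorem StepIn.symm {A : Hyperplane X} {v w : V} (h : StepIn α A v w) : StepIn α A w v := by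
  obtain ⟨h1, h2, K, h3, h4⟩ := h
  exact ⟨h2, h1, K, h3.symm, h4⟩

theorem stepIn_of_dual {A : Hyperplane X} {v w : V} (h : Dual A v w) : StepIn α A v w :=
  ⟨mem_hypCarrier.2 ⟨w, h⟩, mem_hypCarrier.2 ⟨v, h.symm⟩, A, h, Or.inl rfl⟩

theorem eqvGen_stepIn_of_mem {A : Hyperplane X} {e : Sym2 V} (he : e ∈ A.1) {v w : V}
    (hv : v ∈ e) (hw : w ∈ e) : Relation.EqvGen (StepIn α A) v w := by
  induction e with
  | h a b =>
    rw [Sym2.mem_iff] at hv hw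
    have hs : StepIn α A a b := stepIn_of_dual he
    rcases hv with rfl | rfl <;> rcases hw with rfl | rfl
    · exact Relation.EqvGen.refl _
    · exact Relation.EqvGen.rel _ _ hs
    · exact Relation.EqvGen.rel _ _ hs.symm
    · exact Relation.EqvGen.refl _

theorem eqvGen_stepIn_of_eqvGen {A : Hyperplane X} {e f : Sym2 V}
    (h : Relation.EqvGen (SideRel X) e f) (he : e ∈ A.1) :
    ∀ v ∈ e, ∀ w ∈ f, Relation.EqvGen (StepIn α A) v w := by
  induction h with
  | rel e f h =>
    have hf : f ∈ A.1 := (mem_hyperplane_iff A he).2 (Relation.EqvGen.rel _ _ h)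
    suffices ∃ v ∈ e, ∃ w ∈ f, Relation.EqvGen (StepIn α A) v w by
      obtain ⟨v, hv, w, hw, hvw⟩ := this
      intro v' hv' w' hw'
      exact ((eqvGen_stepIn_of_mem he hv' hv).trans _ _ _ hvw).trans _ _ _
        (eqvGen_stepIn_of_mem hf hw hw')
    rcases h with ⟨a, b, c, hab, hac, hbc, rfl, rfl⟩ |
      ⟨a, b, c, d, hab, hcd, hac, hbd, had, hbc, rfl, rfl⟩
    · exact ⟨a, Sym2.mem_mk_left _ _, a, Sym2.mem_mk_left _ _, Relation.EqvGen.refl _⟩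
    · refine ⟨a, Sym2.mem_mk_left _ _, c, Sym2.mem_mk_left _ _, Relation.EqvGen.rel _ _
        ⟨mem_hypCarrier.2 ⟨b, he⟩, mem_hypCarrier.2 ⟨d, hf⟩, ?_⟩⟩
      obtain ⟨K, hK⟩ := exists_dual hac
      refine ⟨K, hK, ?_⟩
      by_cases hAK : A = K
      · subst hAK
        exact Or.inl rfl
      · exact Or.inr (GraphAction.perp_of_hypIntersect
          (hypIntersect_of_square he hK hAK had.symm hbd hcd))
  | refl e => exact fun v hv w hw => eqvGen_stepIn_of_mem he hv hw
  | symm e f h ih =>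
    intro v hv w hw
    exact (ih ((mem_hyperplane_iff A he).2 (h.symm)) w hw v hv).symm
  | trans e f g h h' ih ih' =>
    have hf : f ∈ A.1 := (mem_hyperplane_iff A he).2 h
    have hu : ∃ u, u ∈ f := by
      induction f with
      | h a b => exact ⟨a, Sym2.mem_mk_left _ _⟩
    obtain ⟨u, hu⟩ := hu
    exact fun v hv w hw => (ih he v hv u hu).trans _ _ _ (ih' hf u hu w hw)

variable (α) in
theorem eqvGen_stepIn {A : Hyperplane X} {v w : V} (hv : v ∈ hypCarrier X A)
    (hw : w ∈ hypCarrier X A) : Relation.EqvGen (StepIn α A) v w := by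
  obtain ⟨e, he, hv⟩ := hv
  obtain ⟨f, hf, hw⟩ := hw
  exact eqvGen_stepIn_of_eqvGen ((mem_hyperplane_iff A he).1 hf) he v hv w hw

theorem star_finite (hX : IsQuasiMedian X) (hsp : IsSpecial α) {D : ℕ} (hD : QuotDegBounded α D)
    (s : HypOrbit α) : {t | α.Star s t}.Finite ∧ {t | α.Star s t}.ncard ≤ D + 1 := by
  have hsub : {t | α.Star s t} ⊆ insert s ((quotCrossingGraph α).neighborSet s) := by
    rintro t (rfl | h)
    · exact Set.mem_insert _ _
    · right
      obtain ⟨H, K, rfl, rfl, hi⟩ := h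
      rw [SimpleGraph.mem_neighborSet, quotCrossingGraph, SimpleGraph.fromRel_adj]
      refine ⟨GraphAction.type_ne_of_perp hX hsp (GraphAction.perp_of_hypIntersect hi),
        Or.inl ⟨H, K, rfl, rfl, ?_⟩⟩
      rw [crossingGraph, SimpleGraph.fromRel_adj]
      exact ⟨HypIntersect.ne hX hi, Or.inl hi⟩
  obtain ⟨h1, h2⟩ := hD s
  refine ⟨(h1.insert s).subset hsub, ?_⟩
  calc _ ≤ (insert s ((quotCrossingGraph α).neighborSet s)).ncard :=
        Set.ncard_le_ncard hsub (h1.insert s)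
    _ ≤ _ := (Set.ncard_insert_le _ _).trans (by omega)

end Types

end QM

namespace QM

variable {V : Type*} {X : SimpleGraph V} {q : V}

/-- An edge `vw` dual to `H` that leads one step closer to `q`. -/
def Up (q : V) (H : Hyperplane X) (v w : V) : Prop := Dual H v w ∧ X.dist w q + 1 = X.dist v q

theorem Up.toward {H : Hyperplane X} {v w : V} (h : Up q H v w) : Toward X q v w :=
  toward_of_adj h.1.adj h.2

theorem exists_up {v w : V} (h : X.Adj v w) (hd : X.dist w q + 1 = X.dist v q) :
    ∃ H : Hyperplane X, Up q H v w :=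
  (exists_dual h).imp fun _ h => ⟨h, hd⟩

theorem Up.unique (hX : IsQuasiMedian X) {H : Hyperplane X} {v w w' : V} (h : Up q H v w)
    (h' : Up q H v w') : w = w' := by
  by_contra hne
  have := h.2
  have := h'.2
  refine not_two_lower (o := q) hX h.1.adj h'.1.adj (h.1.adj_of_ne hX h'.1 hne) ?_ ?_ <;>
    rw [X.dist_comm, X.dist_comm (u := q)] <;> assumption

theorem Up.square (hX : IsQuasiMedian X) {H K : Hyperplane X} {v a b : V} (h : Up q H v a)
    (h' : Up q K v b) (hne : H ≠ K) : ∃ s, Up q H b s ∧ Up q K a s ∧ HypIntersect X H K := by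
  obtain ⟨hab, hn⟩ := h.1.not_adj h'.1 hne
  have h1 := h.2
  have h2 := h'.2
  obtain ⟨s, hsa, hsb, hs⟩ := qc (o := q) hX h.1.adj h'.1.adj hab hn
    (by rw [X.dist_comm, X.dist_comm (u := q)]; exact h1)
    (by rw [X.dist_comm, X.dist_comm (u := q)]; exact h2)
  rw [X.dist_comm, X.dist_comm (u := q)] at hs
  have hsv : s ≠ v := by rintro rfl; omega
  exact ⟨s, ⟨h.1.of_square hsb.symm h'.1.adj hsa.symm hsv.symm hab, by omega⟩,
    ⟨h'.1.of_square hsa.symm h.1.adj hsb.symm hsv.symm hab.symm, by omega⟩,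
    hypIntersect_of_square h.1 h'.1 hne hsv hsa.symm hsb.symm⟩

theorem Dual.sameSector_iff_ne (hX : IsQuasiMedian X) {H K : Hyperplane X} {v w : V}
    (h : Dual K v w) : SameSector H v w ↔ H ≠ K :=
  ⟨fun hs hH => h.not_sameSector (hH ▸ hs),
    fun hne => sameSector_of_adj hX h.adj fun h' => hne (h'.unique h)⟩

theorem Up.sameSector_end (hX : IsQuasiMedian X) {H : Hyperplane X} {v w : V} (h : Up q H v w) :
    SameSector H w q ∧ ¬ SameSector H v q :=
  h.toward.sameSector_end hX h.1.not_sameSector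

theorem Toward.sameSector_of_left (hX : IsQuasiMedian X) {H : Hyperplane X} {v w : V}
    (h : Toward X q v w) (hs : SameSector H v q) : SameSector H w q :=
  ((h.sameSector_iff hX (by simp [Toward] : Toward X q w q)).1 hs).2

theorem Up.push (hX : IsQuasiMedian X) {H : Hyperplane X} {v w : V} (h : Toward X q v w) :
    ∀ {v' : V}, Up q H v v' → (Toward X q v' w ∧ ¬ SameSector H v w) ∨
      (SameSector H v w ∧ ∃ w', Up q H w w' ∧ Toward X q v' w' ∧
        (∀ K : Hyperplane X, SameSector K v' w' ↔ SameSector K v w) ∧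
        ∀ K : Hyperplane X, ¬ SameSector K v w → HypIntersect X K H) := by
  have hc := hX.connected
  intro v'
  refine Toward.induction (q := q) hc (P := fun v w => ∀ v' : V, Up q H v v' →
    (Toward X q v' w ∧ ¬ SameSector H v w) ∨
      (SameSector H v w ∧ ∃ w', Up q H w w' ∧ Toward X q v' w' ∧
        (∀ K : Hyperplane X, SameSector K v' w' ↔ SameSector K v w) ∧
        ∀ K : Hyperplane X, ¬ SameSector K v w → HypIntersect X K H)) ?_ ?_ h v'
  · intro v v' hv
    exact .inr ⟨.refl _ _, v', hv, .refl _ _, fun K => by simp [SameSector.refl],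
      fun K hK => absurd (.refl _ _) hK⟩
  · intro v z w hvz hz hzw hvw ih v' hv
    obtain ⟨K, hK⟩ := exists_up hvz hz
    have hs := fun L => hK.toward.sameSector_iff (H := L) hX hzw
    have hsK := fun L => hK.1.sameSector_iff_ne (H := L) hX
    by_cases hHK : H = K
    · subst hHK
      obtain rfl := hv.unique hX hK
      exact .inl ⟨hzw, fun h => hK.1.not_sameSector ((hs _).1 h).1⟩
    · obtain ⟨s, hzs, hvs, hcross⟩ := hv.square hX hK hHK
      rcases ih s hzs with ⟨h1, h2⟩ | ⟨h1, w', hw', h2, h3, h4⟩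
      · exact .inl ⟨(hvs.toward.trans hc h1).1, fun h => h2 ((hs _).1 h).2⟩
      · refine .inr ⟨(hs _).2 ⟨(hsK _).2 hHK, h1⟩, w', hw', (hvs.toward.trans hc h2).1, ?_, ?_⟩
        · intro L
          rw [hvs.toward.sameSector_iff hX h2, hs, h3, hvs.1.sameSector_iff_ne hX, hsK]
        · intro L hL
          rw [hs, hsK] at hL
          by_cases hLK : L = K
          · exact hLK ▸ hypIntersect_symm hcross
          · exact h4 L fun h => hL ⟨hLK, h⟩

theorem Up.pull (hX : IsQuasiMedian X) {G : Type*} [Group G] {α : GraphAction G X}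
    (hsp : IsSpecial α) {H : Hyperplane X} {v w : V} (h : Toward X q v w) :
    ∀ {w' : V}, Up q H w w' →
      (∀ K : Hyperplane X, ¬ SameSector K v w → α.Perp (α.type K) (α.type H)) →
      ∃ v', Up q H v v' ∧ Toward X q v' w' := by
  have hc := hX.connected
  intro w'
  refine Toward.induction (q := q) hc (P := fun v w => ∀ w' : V, Up q H w w' →
      (∀ K : Hyperplane X, ¬ SameSector K v w → α.Perp (α.type K) (α.type H)) →
      ∃ v', Up q H v v' ∧ Toward X q v' w') ?_ ?_ h w'
  · intro v w' hw _
    exact ⟨w', hw, .refl _ _⟩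
  · intro v z w hvz hz hzw hvw ih w' hw hperp
    obtain ⟨K, hK⟩ := exists_up hvz hz
    have hs := fun L => hK.toward.sameSector_iff (H := L) hX hzw
    obtain ⟨z', hz', ht⟩ := ih w' hw fun L hL => hperp L fun h => hL ((hs L).1 h).2
    obtain ⟨hne, hna, s, hsz, hvs, hzs⟩ := (hperp K fun h => hK.1.not_sameSector
      ((hs K).1 h).1).exists_square hX hsp hK.1.symm hz'.1
    have hsq : IsSquare X z v s z' :=
      ⟨hvz.symm, hzs, hz'.1.adj, hvs,
        fun h => hna (k112 hX h hvz.symm hz'.1.adj hvs.symm hzs.symm hne), hna, hsz.symm, hne⟩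
    have h1 := hsq.dist_add hX q
    have h2 := hz'.2
    rw [X.dist_comm, X.dist_comm (v := s), X.dist_comm (v := v), X.dist_comm (v := z')] at h1
    have hs' : Up q K s z' :=
      ⟨(hK.1.symm.of_square hzs hz'.1.adj hvs hsz.symm hne).symm, by omega⟩
    exact ⟨s, ⟨hz'.1.of_square hvs hvz.symm hzs hsz.symm hne.symm, by omega⟩,
      (hs'.toward.trans hc ht).1⟩

open Classical in
/-- Cross `H` towards `q` from `v` if `v` has an edge dual to `H` leading towards `q`. -/
noncomputable def cross (q : V) (H : Hyperplane X) (v : V) : V :=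
  if h : ∃ w, Up q H v w then h.choose else v

def Ready (q : V) (H : Hyperplane X) (v : V) : Prop := (∃ w, Up q H v w) ∨ SameSector H v q

theorem Up.cross_eq (hX : IsQuasiMedian X) {H : Hyperplane X} {v w : V} (h : Up q H v w) :
    cross q H v = w := by
  have h' : ∃ w, Up q H v w := ⟨w, h⟩
  rw [cross, dif_pos h']
  exact h'.choose_spec.unique hX h

theorem SameSector.cross_eq (hX : IsQuasiMedian X) {H : Hyperplane X} {v : V}
    (h : SameSector H v q) : cross q H v = v :=
  dif_neg fun ⟨_, hw⟩ => (hw.sameSector_end hX).2 h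

theorem Ready.toward (hX : IsQuasiMedian X) {H : Hyperplane X} {v w : V} (hv : Ready q H v)
    (h : Toward X q v w) : Ready q H w ∧ Toward X q (cross q H v) (cross q H w) ∧
      ∀ K : Hyperplane X, SameSector K v w → SameSector K (cross q H v) (cross q H w) := by
  rcases hv with ⟨v', hv⟩ | hv
  · rw [hv.cross_eq hX]
    rcases hv.push hX h with ⟨h1, h2⟩ | ⟨h1, w', hw', h2, h3, h4⟩
    · have hw := (h.sameSector_end hX h2).1
      rw [hw.cross_eq hX]
      exact ⟨.inr hw, h1, fun K hK => ((hv.toward.sameSector_iff hX h1).1 hK).2⟩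
    · rw [hw'.cross_eq hX]
      exact ⟨.inl ⟨w', hw'⟩, h2, fun K hK => (h3 K).2 hK⟩
  · have hw := h.sameSector_of_left hX hv
    rw [hv.cross_eq hX, hw.cross_eq hX]
    exact ⟨.inr hw, h, fun _ => id⟩

theorem Ready.hypIntersect (hX : IsQuasiMedian X) {H K : Hyperplane X} {v w : V}
    (hv : Ready q H v) (h : Toward X q v w) (hw : ¬ SameSector H w q) (hK : ¬ SameSector K v w) :
    HypIntersect X K H := by
  rcases hv with ⟨v', hv⟩ | hv
  · rcases hv.push hX h with ⟨h1, h2⟩ | ⟨h1, w', hw', h2, h3, h4⟩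
    · exact absurd (h.sameSector_end hX h2).1 hw
    · exact h4 K hK
  · exact absurd (h.sameSector_of_left hX hv) hw

theorem toward_cross (hX : IsQuasiMedian X) (H : Hyperplane X) (v : V) :
    Toward X q v (cross q H v) := by
  by_cases h : ∃ w, Up q H v w
  · obtain ⟨w, hw⟩ := h
    rw [hw.cross_eq hX]
    exact hw.toward
  · rw [cross, dif_neg h]
    exact .refl _ _

theorem eq_of_not_sameSector_cross (hX : IsQuasiMedian X) {H K : Hyperplane X} {v : V}
    (hK : ¬ SameSector K v (cross q H v)) : K = H ∧ ¬ SameSector H v q := by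
  by_cases h : ∃ w, Up q H v w
  · obtain ⟨w, hw⟩ := h
    rw [hw.cross_eq hX, hw.1.sameSector_iff_ne hX, not_not] at hK
    exact ⟨hK, (hw.sameSector_end hX).2⟩
  · rw [cross, dif_neg h] at hK
    exact absurd (.refl _ _) hK

theorem Ready.pull (hX : IsQuasiMedian X) {G : Type*} [Group G] {α : GraphAction G X}
    (hsp : IsSpecial α) {H : Hyperplane X} {v w : V} (hw : Ready q H w) (h : Toward X q v w)
    (hperp : ∀ K : Hyperplane X, ¬ SameSector K v w → α.Perp (α.type K) (α.type H)) :
    Ready q H v := by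
  rcases hw with ⟨w', hw⟩ | hw
  · obtain ⟨v', hv, -⟩ := hw.pull hX hsp h hperp
    exact .inl ⟨v', hv⟩
  · refine .inr (SameSector.trans ?_ hw)
    by_contra hs
    exact GraphAction.type_ne_of_perp hX hsp (hperp H hs) rfl

end QM

namespace QM

variable {V : Type*} {X : SimpleGraph V} {q : V} {G : Type*} [Group G]

/-- Two chains of vertices moving towards `q`, one from `p` and one from `r`, with the same last
vertex `x n = y 0`. The hyperplanes crossed in the `i`-th step of either chain belong to the star
of `A i`, and `c i` is a vertex of the carrier of `A i` connecting the two steps. -/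
structure BiChain (α : GraphAction G X) (q : V) (A : ℕ → Hyperplane X) (n : ℕ) (p r : V)
    (x y c : ℕ → V) : Prop where
  start : x 0 = p
  mid : x n = y 0
  finish : y n = r
  towardX : ∀ i < n, Toward X q (x i) (x (i + 1))
  towardY : ∀ i < n, Toward X q (y (i + 1)) (y i)
  starX : ∀ i < n, ∀ H : Hyperplane X, ¬ SameSector H (x i) (x (i + 1)) →
    α.Star (α.type (A i)) (α.type H) ∧ (contactGraph X).dist (A i) H ≤ 1
  starY : ∀ i < n, ∀ H : Hyperplane X, ¬ SameSector H (y (i + 1)) (y i) →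
    α.Star (α.type (A i)) (α.type H) ∧ (contactGraph X).dist (A i) H ≤ 1
  perp : ∀ j < n, ∀ i < j, ∀ H K : Hyperplane X, ¬ SameSector H (y (i + 1)) (y i) →
    ¬ SameSector K (x j) (x (j + 1)) → α.Perp (α.type H) (α.type K)
  mem : ∀ i < n, c i ∈ hypCarrier X (A i)
  cx : ∀ i < n, Toward X q (c i) (x (i + 1))
  cy : ∀ i < n, Toward X q (c i) (y i)
  cxPerp : ∀ i < n, ∀ H K : Hyperplane X, ¬ SameSector H (c i) (x (i + 1)) →
    ¬ SameSector K (x i) (x (i + 1)) → α.Perp (α.type H) (α.type K)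
  cyPerp : ∀ i < n, ∀ H K : Hyperplane X, ¬ SameSector H (c i) (y i) →
    ¬ SameSector K (y (i + 1)) (y i) → α.Perp (α.type H) (α.type K)

theorem SameSector.or_of_not {H : Hyperplane X} {v w u : V} (h : ¬ SameSector H v u) :
    ¬ SameSector H v w ∨ ¬ SameSector H w u := by
  by_contra! h'
  exact h (h'.1.trans h'.2)

theorem not_sameSector_cross (hX : IsQuasiMedian X) {H K : Hyperplane X} {v w : V}
    (h : ¬ SameSector K v (cross q H w)) :
    ¬ SameSector K v w ∨ (K = H ∧ ¬ SameSector H w q) :=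
  (SameSector.or_of_not h).imp_right (eq_of_not_sameSector_cross hX)

namespace BiChain

variable {α : GraphAction G X} {A : ℕ → Hyperplane X} {n : ℕ} {p r : V} {x y c : ℕ → V}

theorem insert (hX : IsQuasiMedian X) (hsp : IsSpecial α) (h : BiChain α q A n p r x y c)
    {i : ℕ} (hi : i < n) {H : Hyperplane X} {z : V} (hz : Up q H (x (i + 1)) z)
    (hstar : α.Star (α.type (A i)) (α.type H))
    (hy : ∀ a < i, ∀ K : Hyperplane X, ¬ SameSector K (y (a + 1)) (y a) →
      α.Perp (α.type K) (α.type H))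
    (hc : ∀ K : Hyperplane X, ¬ SameSector K (c i) (x (i + 1)) → α.Perp (α.type K) (α.type H))
    {x' y' c' : ℕ → V}
    (hx0 : ∀ j ≤ i, x' j = x j) (hx1 : ∀ j, i < j → x' j = cross q H (x j))
    (hy0 : ∀ j, i < j → y' j = y j) (hy1 : ∀ j ≤ i, y' j = cross q H (y j))
    (hc0 : ∀ j, j ≠ i → c' j = c j) (hc1 : c' i = cross q H (c i)) :
    BiChain α q A n p r x' y' c' := by
  have hcon := hX.connected
  have tw : ∀ {v w : V}, Toward X q v w → Toward X q v (cross q H w) := fun h' =>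
    (h'.trans hcon (toward_cross hX H _)).1
  have rx : ∀ j, i < j → j ≤ n → Ready q H (x j) := by
    intro j hj
    induction j, hj using Nat.le_induction with
    | base => exact fun _ => .inl ⟨z, hz⟩
    | succ j _ ih => exact fun hjn => ((ih (by omega)).toward hX (h.towardX j (by omega))).1
  have ry : ∀ j ≤ i, Ready q H (y j) := by
    intro j
    induction j with
    | zero => exact fun _ => h.mid ▸ rx n hi le_rfl
    | succ j ih =>
      exact fun hj => (ih (by omega)).pull hX hsp (h.towardY j (by omega)) (hy j hj)
  have sy : ∀ j ≤ i, ¬ SameSector H (y j) q → ¬ SameSector H (y 0) q := by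
    intro j
    induction j with
    | zero => exact fun _ => id
    | succ j ih =>
      refine fun hj hs => ih (by omega) fun h0 => hs (SameSector.trans ?_ h0)
      by_contra hK
      exact GraphAction.type_ne_of_perp hX hsp (hy j hj H hK) rfl
  have sx : ∀ j ≤ n, ¬ SameSector H (y 0) q → ¬ SameSector H (x j) q := by
    intro j hj hs
    rw [← h.mid] at hs
    induction hj using Nat.decreasingInduction with
    | self => exact hs
    | of_succ j hj ih => exact fun h' => ih ((h.towardX j hj).sameSector_of_left hX h')
  have rc : ∃ w, Up q H (c i) w := by
    refine (Ready.pull hX hsp (.inl ⟨z, hz⟩) (h.cx i hi) hc).resolve_right fun hs => ?_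
    exact (hz.sameSector_end hX).2 ((h.cx i hi).sameSector_of_left hX hs)
  obtain ⟨w, hw⟩ := rc
  have rc : Ready q H (c i) := .inl ⟨w, hw⟩
  have near : (contactGraph X).dist (A i) H ≤ 1 := by
    obtain ⟨b, hb⟩ := mem_hypCarrier.1 (h.mem i hi)
    exact (dual_reachable hb hw.1).1
  have rdx := fun j (hj : i < j) (hjn : j < n) => (rx j hj hjn.le).toward hX (h.towardX j hjn)
  have rdy := fun j (hj : j < i) => (ry (j + 1) hj).toward hX (h.towardY j (by omega))
  have ox : ∀ j < n, ∀ K : Hyperplane X, ¬ SameSector K (x' j) (x' (j + 1)) →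
      ¬ SameSector K (x j) (x (j + 1)) ∨ (j = i ∧ K = H) := by
    intro j hj K hK
    rcases lt_trichotomy j i with hji | rfl | hji
    · rw [hx0 j hji.le, hx0 (j + 1) hji] at hK
      exact .inl hK
    · rw [hx0 j le_rfl, hx1 (j + 1) (by omega)] at hK
      exact (not_sameSector_cross hX hK).imp_right fun h => ⟨rfl, h.1⟩
    · rw [hx1 j hji, hx1 (j + 1) (by omega)] at hK
      exact .inl fun hs => hK ((rdx j hji hj).2.2 K hs)
  have oy : ∀ j < n, ∀ K : Hyperplane X, ¬ SameSector K (y' (j + 1)) (y' j) →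
      ¬ SameSector K (y (j + 1)) (y j) ∨ (j = i ∧ K = H ∧ ¬ SameSector H (y i) q) := by
    intro j hj K hK
    rcases lt_trichotomy j i with hji | rfl | hji
    · rw [hy1 j hji.le, hy1 (j + 1) hji] at hK
      exact .inl fun hs => hK ((rdy j hji).2.2 K hs)
    · rw [hy1 j le_rfl, hy0 (j + 1) (by omega)] at hK
      exact (not_sameSector_cross hX hK).imp_right fun h => ⟨rfl, h⟩
    · rw [hy0 j hji, hy0 (j + 1) (by omega)] at hK
      exact .inl hK
  constructor
  · rw [hx0 0 (Nat.zero_le _), h.start]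
  · rw [hx1 n hi, hy1 0 (Nat.zero_le _), h.mid]
  · rw [hy0 n hi, h.finish]
  · intro j hj
    rcases lt_trichotomy j i with hji | rfl | hji
    · rw [hx0 j hji.le, hx0 (j + 1) hji]
      exact h.towardX j hj
    · rw [hx0 j le_rfl, hx1 (j + 1) (by omega)]
      exact tw (h.towardX j hj)
    · rw [hx1 j hji, hx1 (j + 1) (by omega)]
      exact (rdx j hji hj).2.1
  · intro j hj
    rcases lt_trichotomy j i with hji | rfl | hji
    · rw [hy1 j hji.le, hy1 (j + 1) hji]
      exact (rdy j hji).2.1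
    · rw [hy1 j le_rfl, hy0 (j + 1) (by omega)]
      exact tw (h.towardY j hj)
    · rw [hy0 j hji, hy0 (j + 1) (by omega)]
      exact h.towardY j hj
  · intro j hj K hK
    rcases ox j hj K hK with hK | ⟨rfl, rfl⟩
    · exact h.starX j hj K hK
    · exact ⟨hstar, near⟩
  · intro j hj K hK
    rcases oy j hj K hK with hK | ⟨rfl, rfl, -⟩
    · exact h.starY j hj K hK
    · exact ⟨hstar, near⟩
  · intro j hj k hk L K hL hK
    rcases oy k (hk.trans hj) L hL with hL | ⟨rfl, rfl, hs⟩ <;>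
      rcases ox j hj K hK with hK | ⟨rfl, rfl⟩
    · exact h.perp j hj k hk L K hL hK
    · exact hy k hk L hL
    · exact (GraphAction.perp_of_hypIntersect ((rx j hk hj.le).hypIntersect hX (h.towardX j hj)
        (sx _ hj (sy k le_rfl hs)) hK)).symm
    · exact absurd hk (lt_irrefl _)
  · intro j hj
    by_cases hji : j = i
    · subst hji
      rw [hc1, hw.cross_eq hX]
      exact mem_hypCarrier_of_star hX hsp (h.mem j hj) hw.1 hstar
    · rw [hc0 j hji]
      exact h.mem j hj
  · intro j hj
    rcases lt_trichotomy j i with hji | rfl | hji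
    · rw [hc0 j hji.ne, hx0 (j + 1) hji]
      exact h.cx j hj
    · rw [hc1, hx1 (j + 1) (by omega)]
      exact (rc.toward hX (h.cx j hj)).2.1
    · rw [hc0 j hji.ne', hx1 (j + 1) (by omega)]
      exact tw (h.cx j hj)
  · intro j hj
    rcases lt_trichotomy j i with hji | rfl | hji
    · rw [hc0 j hji.ne, hy1 j hji.le]
      exact tw (h.cy j hj)
    · rw [hc1, hy1 j le_rfl]
      exact (rc.toward hX (h.cy j hj)).2.1
    · rw [hc0 j hji.ne', hy0 j hji]
      exact h.cy j hj
  · intro j hj L K hL hK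
    rcases lt_trichotomy j i with hji | rfl | hji
    · rw [hc0 j hji.ne, hx0 (j + 1) hji] at hL
      rw [hx0 j hji.le, hx0 (j + 1) hji] at hK
      exact h.cxPerp j hj L K hL hK
    · rw [hc1, hx1 (j + 1) (by omega)] at hL
      have hL' : ¬ SameSector L (c j) (x (j + 1)) :=
        fun hs => hL ((rc.toward hX (h.cx j hj)).2.2 L hs)
      rcases ox j hj K hK with hK | ⟨-, rfl⟩
      · exact h.cxPerp j hj L K hL' hK
      · exact hc L hL'
    · rw [hc0 j hji.ne', hx1 (j + 1) (by omega)] at hL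
      have hK' := (ox j hj K hK).resolve_right fun h => hji.ne' h.1
      rcases not_sameSector_cross hX hL with hL | ⟨rfl, hs⟩
      · exact h.cxPerp j hj L K hL hK'
      · exact (GraphAction.perp_of_hypIntersect ((rx j hji hj.le).hypIntersect hX
          (h.towardX j hj) hs hK')).symm
  · intro j hj L K hL hK
    rcases lt_trichotomy j i with hji | rfl | hji
    · rw [hc0 j hji.ne, hy1 j hji.le] at hL
      have hK' := (oy j hj K hK).resolve_right fun h => hji.ne h.1
      rcases not_sameSector_cross hX hL with hL | ⟨rfl, hs⟩
      · exact h.cyPerp j hj L K hL hK'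
      · exact (hy j hji K hK').symm
    · rw [hc1, hy1 j le_rfl] at hL
      have hL' : ¬ SameSector L (c j) (y j) :=
        fun hs => hL ((rc.toward hX (h.cy j hj)).2.2 L hs)
      rcases oy j hj K hK with hK | ⟨-, rfl, hs⟩
      · exact h.cyPerp j hj L K hL' hK
      · exact GraphAction.perp_of_hypIntersect (rc.hypIntersect hX (h.cy j hj) hs hL')
    · rw [hc0 j hji.ne', hy0 j hji] at hL
      rw [hy0 j hji, hy0 (j + 1) (by omega)] at hK
      exact h.cyPerp j hj L K hL hK

theorem reverse {x' y' c' : ℕ → V} {A' : ℕ → Hyperplane X} (h : BiChain α q A n p r x y c)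
    (hx : ∀ j ≤ n, x' j = y (n - j)) (hy : ∀ j ≤ n, y' j = x (n - j))
    (hc : ∀ j < n, c' j = c (n - 1 - j)) (hA : ∀ j < n, A' j = A (n - 1 - j)) :
    BiChain α q A' n r p x' y' c' := by
  have e1 : ∀ j < n, n - j = n - 1 - j + 1 := by omega
  have e2 : ∀ j < n, n - (j + 1) = n - 1 - j := by omega
  have lt : ∀ j < n, n - 1 - j < n := by omega
  have x0 : ∀ j < n, x' j = y (n - 1 - j + 1) := fun j hj => by rw [hx j hj.le, e1 j hj]
  have x1 : ∀ j < n, x' (j + 1) = y (n - 1 - j) := fun j hj => by rw [hx _ hj, e2 j hj]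
  have y0 : ∀ j < n, y' j = x (n - 1 - j + 1) := fun j hj => by rw [hy j hj.le, e1 j hj]
  have y1 : ∀ j < n, y' (j + 1) = x (n - 1 - j) := fun j hj => by rw [hy _ hj, e2 j hj]
  constructor
  · rw [hx 0 (Nat.zero_le _), Nat.sub_zero, h.finish]
  · rw [hx n le_rfl, hy 0 (Nat.zero_le _), Nat.sub_self, Nat.sub_zero, h.mid]
  · rw [hy n le_rfl, Nat.sub_self, h.start]
  · intro j hj
    rw [x0 j hj, x1 j hj]
    exact h.towardY _ (lt j hj)
  · intro j hj
    rw [y0 j hj, y1 j hj]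
    exact h.towardX _ (lt j hj)
  · intro j hj
    rw [x0 j hj, x1 j hj, hA j hj]
    exact h.starY _ (lt j hj)
  · intro j hj
    rw [y0 j hj, y1 j hj, hA j hj]
    exact h.starX _ (lt j hj)
  · intro j hj i hi H K
    have hin := hi.trans hj
    rw [x0 j hj, x1 j hj, y0 i hin, y1 i hin]
    exact fun hH hK => (h.perp _ (lt i hin) (n - 1 - j) (by omega) K H hK hH).symm
  · intro j hj
    rw [hc j hj, hA j hj]
    exact h.mem _ (lt j hj)
  · intro j hj
    rw [x1 j hj, hc j hj]
    exact h.cy _ (lt j hj)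
  · intro j hj
    rw [y0 j hj, hc j hj]
    exact h.cx _ (lt j hj)
  · intro j hj H K
    rw [x0 j hj, x1 j hj, hc j hj]
    exact h.cyPerp _ (lt j hj) H K
  · intro j hj H K
    rw [y0 j hj, y1 j hj, hc j hj]
    exact h.cxPerp _ (lt j hj) H K

end BiChain

end QM

namespace QM

variable {V : Type*} {X : SimpleGraph V} {q : V} {G : Type*} [Group G]

namespace BiChain

variable {α : GraphAction G X} {A : ℕ → Hyperplane X} {n : ℕ} {p r : V} {x y c : ℕ → V}

theorem exists_lt (hX : IsQuasiMedian X) (hsp : IsSpecial α) (h : BiChain α q A n p r x y c)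
    {i : ℕ} (hi : i < n) {H K : Hyperplane X} {z : V} (hz : Up q H (x (i + 1)) z)
    (hK : ¬ SameSector K (x i) (x (i + 1))) (hHK : α.type H = α.type K) :
    ∃ x' y' c', BiChain α q A n p r x' y' c' ∧
      ∑ j ∈ Finset.range (n + 1), (X.dist (x' j) q + X.dist (y' j) q) <
        ∑ j ∈ Finset.range (n + 1), (X.dist (x j) q + X.dist (y j) q) := by
  classical
  refine ⟨fun j => if j ≤ i then x j else cross q H (x j),
    fun j => if j ≤ i then cross q H (y j) else y j,
    fun j => if j = i then cross q H (c j) else c j,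
    h.insert hX hsp hi hz (hHK ▸ (h.starX i hi K hK).1)
      (fun a ha L hL => hHK ▸ h.perp i hi a ha L K hL hK)
      (fun L hL => hHK ▸ h.cxPerp i hi L K hL hK)
      (fun j hj => if_pos hj) (fun j hj => if_neg hj.not_ge) (fun j hj => if_neg hj.not_ge)
      (fun j hj => if_pos hj) (fun j hj => if_neg hj) (if_pos rfl), ?_⟩
  have hcross : ∀ v, X.dist (cross q H v) q ≤ X.dist v q := fun v =>
    (Nat.le_add_left _ _).trans_eq (toward_cross hX H v)
  refine Finset.sum_lt_sum (fun j _ => ?_) ⟨i + 1, by simpa using hi, ?_⟩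
  · have := hcross (x j)
    have := hcross (y j)
    dsimp only
    split_ifs <;> omega
  · have := hz.2
    have h' : ¬ i + 1 ≤ i := by omega
    simp only [if_neg h', hz.cross_eq hX]
    omega

theorem exists_normal (hX : IsQuasiMedian X) (hsp : IsSpecial α) {x y c : ℕ → V}
    (h : BiChain α q A n p r x y c) :
    ∃ x y c, BiChain α q A n p r x y c ∧
      (∀ i < n, ∀ H K : Hyperplane X, ∀ z, Up q H (x (i + 1)) z →
        ¬ SameSector K (x i) (x (i + 1)) → α.type H ≠ α.type K) ∧
      (∀ i < n, ∀ H K : Hyperplane X, ∀ z, Up q H (y i) z →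
        ¬ SameSector K (y (i + 1)) (y i) → α.type H ≠ α.type K) := by
  by_cases hn : (∀ i < n, ∀ H K : Hyperplane X, ∀ z, Up q H (x (i + 1)) z →
        ¬ SameSector K (x i) (x (i + 1)) → α.type H ≠ α.type K) ∧
      (∀ i < n, ∀ H K : Hyperplane X, ∀ z, Up q H (y i) z →
        ¬ SameSector K (y (i + 1)) (y i) → α.type H ≠ α.type K)
  · exact ⟨x, y, c, h, hn⟩
  · have key : ∃ x' y' c', BiChain α q A n p r x' y' c' ∧
        ∑ j ∈ Finset.range (n + 1), (X.dist (x' j) q + X.dist (y' j) q) <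
          ∑ j ∈ Finset.range (n + 1), (X.dist (x j) q + X.dist (y j) q) := by
      rw [not_and_or] at hn
      push Not at hn
      rcases hn with ⟨i, hi, H, K, z, hz, hK, hHK⟩ | ⟨i, hi, H, K, z, hz, hK, hHK⟩
      · exact h.exists_lt hX hsp hi hz hK hHK
      · have hrev : BiChain α q (fun j => A (n - 1 - j)) n r p (fun j => y (n - j))
            (fun j => x (n - j)) (fun j => c (n - 1 - j)) :=
          h.reverse (fun _ _ => rfl) (fun _ _ => rfl) (fun _ _ => rfl) (fun _ _ => rfl)
        have e1 : n - (n - 1 - i + 1) = i := by omega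
        have e2 : n - (n - 1 - i) = i + 1 := by omega
        obtain ⟨x', y', c', h', hlt⟩ := hrev.exists_lt hX hsp (i := n - 1 - i) (by omega)
          (z := z) (by simpa only [e1] using hz) (by simpa only [e1, e2] using hK) hHK
        refine ⟨_, _, _, h'.reverse (fun _ _ => rfl) (fun _ _ => rfl) (fun _ _ => rfl)
          (fun j hj => ?_), ?_⟩
        · congr 1
          omega
        · have e := Finset.sum_range_reflect
            (fun j => X.dist (x' j) q + X.dist (y' j) q) (n + 1)
          have e' := Finset.sum_range_reflect
            (fun j => X.dist (x j) q + X.dist (y j) q) (n + 1)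
          simp only [Nat.add_sub_cancel] at e e'
          simp only [add_comm (X.dist (y' _) q), add_comm (X.dist (y _) q)] at hlt ⊢
          omega
    obtain ⟨x', y', c', h', hlt⟩ := key
    exact exists_normal hX hsp h'
termination_by ∑ j ∈ Finset.range (n + 1), (X.dist (x j) q + X.dist (y j) q)

theorem toward_mid (hc : X.Connected) (h : BiChain α q A n p r x y c) :
    Toward X q r (y 0) := by
  have : ∀ j ≤ n, Toward X q (y j) (y 0) := by
    intro j
    induction j with
    | zero => exact fun _ => .refl _ _
    | succ j ih => exact fun hj => ((h.towardY j hj).trans hc (ih (by omega))).1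
  exact h.finish ▸ this n le_rfl

theorem addBlock (hc : X.Connected) (h : BiChain α q A n p r x y c)
    (hr : r ∈ hypCarrier X (A n)) :
    ∃ x y c, BiChain α q A (n + 1) p r x y c ∧ c n = y n := by
  classical
  have hx : ∀ j ≤ n, Function.update x (n + 1) (x n) j = x j := fun j hj =>
    Function.update_of_ne (by omega) _ _
  have hy : ∀ j ≤ n, Function.update y (n + 1) r j = y j := fun j hj =>
    Function.update_of_ne (by omega) _ _
  have hcc : ∀ j < n, Function.update c n r j = c j := fun j hj =>
    Function.update_of_ne (by omega) _ _
  have hx1 : Function.update x (n + 1) (x n) (n + 1) = x n := Function.update_self _ _ _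
  have hy1 : Function.update y (n + 1) r (n + 1) = r := Function.update_self _ _ _
  have hc1 : Function.update c n r n = r := Function.update_self _ _ _
  have hcases : ∀ j < n + 1, j < n ∨ j = n := by omega
  refine ⟨Function.update x (n + 1) (x n), Function.update y (n + 1) r, Function.update c n r,
    ?_, by rw [hc1, hy n le_rfl, h.finish]⟩
  have mid := h.toward_mid hc
  constructor
  · rw [hx 0 (Nat.zero_le _), h.start]
  · rw [hx1, hy 0 (Nat.zero_le _), h.mid]
  · exact hy1
  · intro j hj
    rcases hcases j hj with hj | rfl
    · rw [hx j hj.le, hx (j + 1) hj]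
      exact h.towardX j hj
    · rw [hx j le_rfl, hx1]
      exact .refl _ _
  · intro j hj
    rcases hcases j hj with hj | rfl
    · rw [hy j hj.le, hy (j + 1) hj]
      exact h.towardY j hj
    · rw [hy j le_rfl, hy1, h.finish]
      exact .refl _ _
  · intro j hj
    rcases hcases j hj with hj | rfl
    · rw [hx j hj.le, hx (j + 1) hj]
      exact h.starX j hj
    · rw [hx j le_rfl, hx1]
      exact fun H hH => absurd (.refl _ _) hH
  · intro j hj
    rcases hcases j hj with hj | rfl
    · rw [hy j hj.le, hy (j + 1) hj]
      exact h.starY j hj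
    · rw [hy j le_rfl, hy1, h.finish]
      exact fun H hH => absurd (.refl _ _) hH
  · intro j hj i hi
    rw [hy i (by omega), hy (i + 1) (by omega)]
    rcases hcases j hj with hj | rfl
    · rw [hx j hj.le, hx (j + 1) hj]
      exact h.perp j hj i hi
    · rw [hx j le_rfl, hx1]
      exact fun H K _ hK => absurd (.refl _ _) hK
  · intro j hj
    rcases hcases j hj with hj | rfl
    · rw [hcc j hj]
      exact h.mem j hj
    · rwa [hc1]
  · intro j hj
    rcases hcases j hj with hj | rfl
    · rw [hx (j + 1) hj, hcc j hj]
      exact h.cx j hj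
    · rwa [hx1, hc1, h.mid]
  · intro j hj
    rcases hcases j hj with hj | rfl
    · rw [hy j hj.le, hcc j hj]
      exact h.cy j hj
    · rw [hy j le_rfl, hc1, h.finish]
      exact .refl _ _
  · intro j hj
    rcases hcases j hj with hj | rfl
    · rw [hx j hj.le, hx (j + 1) hj, hcc j hj]
      exact h.cxPerp j hj
    · rw [hx j le_rfl, hx1]
      exact fun H K _ hK => absurd (.refl _ _) hK
  · intro j hj
    rcases hcases j hj with hj | rfl
    · rw [hy j hj.le, hy (j + 1) hj, hcc j hj]
      exact h.cyPerp j hj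
    · rw [hy j le_rfl, hy1, h.finish]
      exact fun H K _ hK => absurd (.refl _ _) hK

theorem changeEnd (h : BiChain α q A (n + 1) p r x y c) (hcy : c n = y n) {r' : V}
    (ht : Toward X q r' (y n))
    (hs : ∀ H : Hyperplane X, ¬ SameSector H r' (y n) →
      α.Star (α.type (A n)) (α.type H) ∧ (contactGraph X).dist (A n) H ≤ 1) :
    ∃ x y c, BiChain α q A (n + 1) p r' x y c ∧ c n = y n := by
  classical
  have hy : ∀ j ≤ n, Function.update y (n + 1) r' j = y j := fun j hj =>
    Function.update_of_ne (by omega) _ _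
  have hy1 : Function.update y (n + 1) r' (n + 1) = r' := Function.update_self _ _ _
  have hcases : ∀ j < n + 1, j < n ∨ j = n := by omega
  refine ⟨x, Function.update y (n + 1) r', c, ?_, by rw [hcy, hy n le_rfl]⟩
  constructor
  · exact h.start
  · rw [hy 0 (Nat.zero_le _), h.mid]
  · exact hy1
  · exact h.towardX
  · intro j hj
    rcases hcases j hj with hj' | rfl
    · rw [hy j hj'.le, hy (j + 1) hj']
      exact h.towardY j hj
    · rwa [hy j le_rfl, hy1]
  · exact h.starX
  · intro j hj
    rcases hcases j hj with hj' | rfl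
    · rw [hy j hj'.le, hy (j + 1) hj']
      exact h.starY j hj
    · rwa [hy j le_rfl, hy1]
  · intro j hj i hi
    rw [hy i (by omega), hy (i + 1) (by omega)]
    exact h.perp j hj i hi
  · exact h.mem
  · exact h.cx
  · intro j hj
    rw [hy j (by omega)]
    exact h.cy j hj
  · exact h.cxPerp
  · intro j hj
    rcases hcases j hj with hj' | rfl
    · rw [hy j hj'.le, hy (j + 1) hj']
      exact h.cyPerp j hj
    · rw [hy j le_rfl, hcy]
      exact fun H K hH => absurd (.refl _ _) hH

theorem end_down (hX : IsQuasiMedian X) (h : BiChain α q A (n + 1) p r x y c) (hcy : c n = y n)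
    {r' : V} {H : Hyperplane X} (hup : Up q H r' r) (hr' : r' ∈ hypCarrier X (A n))
    (hstar : α.Star (α.type (A n)) (α.type H)) :
    ∃ x y c, BiChain α q A (n + 1) p r' x y c ∧ c n = y n := by
  have ht := h.towardY n (Nat.lt_succ_self n)
  rw [h.finish] at ht
  refine h.changeEnd hcy (hup.toward.trans hX.connected ht).1 fun K hK => ?_
  rcases SameSector.or_of_not (w := r) hK with hK | hK
  · rw [hup.1.sameSector_iff_ne hX, not_not] at hK
    subst hK
    obtain ⟨b, hb⟩ := mem_hypCarrier.1 hr'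
    exact ⟨hstar, (dual_reachable hb hup.1).1⟩
  · exact h.starY n (Nat.lt_succ_self n) K (by rwa [h.finish])

theorem end_up (hX : IsQuasiMedian X) (hsp : IsSpecial α) (h : BiChain α q A (n + 1) p r x y c)
    (hcy : c n = y n) {r' : V} {H : Hyperplane X} (hup : Up q H r r')
    (hstar : α.Star (α.type (A n)) (α.type H)) :
    ∃ x y c, BiChain α q A (n + 1) p r' x y c ∧ c n = y n := by
  classical
  have ht := h.towardY n (Nat.lt_succ_self n)
  have hs := h.starY n (Nat.lt_succ_self n)
  rw [h.finish] at ht hs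
  rcases hup.push hX ht with ⟨h1, -⟩ | ⟨-, w, hw, h1, h2, -⟩
  · exact h.changeEnd hcy h1 fun K hK => hs K fun h' =>
      hK ((hup.toward.sameSector_iff hX h1).1 h').2
  · have hrev : BiChain α q (fun j => A (n - j)) (n + 1) r p (fun j => y (n + 1 - j))
        (fun j => x (n + 1 - j)) (fun j => c (n - j)) :=
      h.reverse (fun _ _ => rfl) (fun _ _ => rfl) (fun _ _ => rfl) (fun _ _ => rfl)
    have hins := hrev.insert hX hsp (i := 0) (Nat.succ_pos n) (H := H) (z := w) hw hstar
      (fun a ha => absurd ha (Nat.not_lt_zero a))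
      (fun K hK => absurd (by simpa [hcy] using SameSector.refl K (y n)) hK)
      (x' := fun j => if j ≤ 0 then y (n + 1 - j) else cross q H (y (n + 1 - j)))
      (y' := fun j => if j ≤ 0 then cross q H (x (n + 1 - j)) else x (n + 1 - j))
      (c' := fun j => if j = 0 then cross q H (c (n - j)) else c (n - j))
      (fun j hj => if_pos hj) (fun j hj => if_neg hj.not_ge) (fun j hj => if_neg hj.not_ge)
      (fun j hj => if_pos hj) (fun j hj => if_neg hj) (if_pos rfl)
    have hback := hins.reverse (A' := A) (fun _ _ => rfl) (fun _ _ => rfl) (fun _ _ => rfl)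
      (fun j hj => by congr 1; omega)
    have e : n + 1 - n = 1 := by omega
    refine hback.changeEnd ?_ (r' := r') ?_ ?_
    · simp [e, hcy]
    · simpa [e, hw.cross_eq hX] using h1
    · simpa [e, hw.cross_eq hX, h2] using hs

theorem end_step (hX : IsQuasiMedian X) (hsp : IsSpecial α)
    (h : ∃ x y c, BiChain α q A (n + 1) p r x y c ∧ c n = y n) {r' : V}
    (hstep : StepIn α (A n) r r') :
    ∃ x y c, BiChain α q A (n + 1) p r' x y c ∧ c n = y n := by
  obtain ⟨x, y, c, h, hcy⟩ := h
  obtain ⟨hr, hr', H, hH, hstar⟩ := hstep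
  have h1 := dist_adj_le hX.connected q hH.adj
  have h2 := dist_adj_le hX.connected q hH.adj.symm
  rw [X.dist_comm, X.dist_comm (v := r')] at h1
  rw [X.dist_comm, X.dist_comm (v := r)] at h2
  rcases lt_trichotomy (X.dist r q) (X.dist r' q) with hlt | heq | hlt
  · exact h.end_down hX hcy ⟨hH.symm, by omega⟩ hr' hstar
  · obtain ⟨s, hrs, hrs', hd⟩ := tc (o := q) hX hH.adj
      (by rw [X.dist_comm, heq, X.dist_comm])
    rw [X.dist_comm, X.dist_comm (u := q)] at hd
    obtain ⟨x, y, c, h, hcy⟩ :=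
      h.end_up hX hsp hcy ⟨hH.of_triangle hrs hrs', hd⟩ hstar
    exact h.end_down hX hcy ⟨hH.symm.of_triangle hrs' hrs, by omega⟩ hr' hstar
  · exact h.end_up hX hsp hcy ⟨hH, by omega⟩ hstar

end BiChain

theorem exists_biChain (hX : IsQuasiMedian X) {α : GraphAction G X} (hsp : IsSpecial α)
    {A : ℕ → Hyperplane X} {p : V} (hp : p ∈ hypCarrier X (A 0)) (n : ℕ)
    (hA : ∀ i < n, ∃ v, v ∈ hypCarrier X (A i) ∧ v ∈ hypCarrier X (A (i + 1))) :
    ∀ r ∈ hypCarrier X (A n), ∃ x y c, BiChain α q A (n + 1) p r x y c ∧ c n = y n := by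
  have move : ∀ n, ∀ v ∈ hypCarrier X (A n),
      (∃ x y c, BiChain α q A (n + 1) p v x y c ∧ c n = y n) → ∀ r ∈ hypCarrier X (A n),
      ∃ x y c, BiChain α q A (n + 1) p r x y c ∧ c n = y n := by
    intro n v hv hex r hr
    refine Iff.mp ?_ hex
    have hvr := eqvGen_stepIn α hv hr
    clear hv hr hex
    induction hvr with
    | rel v w h => exact ⟨fun hex => BiChain.end_step hX hsp hex h,
        fun hex => BiChain.end_step hX hsp hex h.symm⟩
    | refl => exact Iff.rfl
    | symm _ _ _ ih => exact ih.symm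
    | trans _ _ _ _ _ ih1 ih2 => exact ih1.trans ih2
  induction n with
  | zero =>
    refine move 0 p hp (BiChain.addBlock (x := fun _ => p) (y := fun _ => p) (c := fun _ => p)
      hX.connected ?_ hp)
    constructor <;> first | rfl | exact fun j hj => absurd hj (Nat.not_lt_zero j)
  | succ n ih =>
    obtain ⟨v, hv, hv'⟩ := hA n (Nat.lt_succ_self n)
    obtain ⟨x, y, c, h, -⟩ := ih (fun i hi => hA i (by omega)) v hv
    exact move (n + 1) v hv' (h.addBlock hX.connected hv')

end QM

namespace QM

variable {V : Type*} {X : SimpleGraph V} {q : V} {G : Type*} [Group G]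

theorem ncard_biUnion_le_mul {ι β : Type*} {s : Set ι} {f : ι → Set β} {a b : ℕ} (hs : s.Finite)
    (hs' : s.ncard ≤ a) (hf : ∀ i ∈ s, (f i).Finite ∧ (f i).ncard ≤ b) :
    (⋃ i ∈ s, f i).Finite ∧ (⋃ i ∈ s, f i).ncard ≤ a * b := by
  classical
  refine ⟨hs.biUnion fun i hi => (hf i hi).1, ?_⟩
  have key : ∀ t : Finset ι, (∀ i ∈ t, (f i).ncard ≤ b) →
      (⋃ i ∈ t, f i).ncard ≤ t.card * b := by
    intro t
    induction t using Finset.induction_on with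
    | empty => simp
    | insert i t hit ih =>
      intro h
      rw [Finset.set_biUnion_insert, Finset.card_insert_of_notMem hit, Nat.succ_mul]
      have := Set.ncard_union_le (f i) (⋃ i ∈ t, f i)
      have := h i (Finset.mem_insert_self _ _)
      have := ih fun j hj => h j (Finset.mem_insert_of_mem hj)
      omega
  have h := key hs.toFinset fun i hi => (hf i (hs.mem_toFinset.1 hi)).2
  rw [← Set.ncard_eq_toFinset_card s hs] at h
  simp only [Set.Finite.mem_toFinset] at h
  exact h.trans (Nat.mul_le_mul_right _ hs')

/-- The path from `v` towards `q` to `w` crosses only hyperplanes with type in `S`, and it cannot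
be prolonged by such hyperplanes. -/
structure IsMaxPath (α : GraphAction G X) (q : V) (S : Set (HypOrbit α)) (v w : V) : Prop where
  toward : Toward X q v w
  mem : ∀ H : Hyperplane X, ¬ SameSector H v w → α.type H ∈ S
  max : ∀ (H : Hyperplane X) z, Up q H w z → α.type H ∉ S

theorem IsMaxPath.toward_of_toward (hX : IsQuasiMedian X) {α : GraphAction G X}
    {S : Set (HypOrbit α)} {v w w' : V} (h : Toward X q v w)
    (hS : ∀ H : Hyperplane X, ¬ SameSector H v w → α.type H ∈ S) (h' : IsMaxPath α q S v w') :
    Toward X q w w' := by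
  revert hS w'
  refine Toward.induction (q := q) hX.connected (P := fun v w => ∀ {w' : V},
    (∀ H : Hyperplane X, ¬ SameSector H v w → α.type H ∈ S) → IsMaxPath α q S v w' →
    Toward X q w w') (fun v w' _ h' => h'.toward) ?_ h
  intro v z w hvz hz hzw _ ih w' hS h'
  obtain ⟨K, hK⟩ := exists_up hvz hz
  have hs := fun L => hK.toward.sameSector_iff (H := L) hX hzw
  rcases hK.push hX h'.toward with ⟨h1, -⟩ | ⟨-, u, hu, -⟩
  · exact ih (fun H hH => hS H fun h => hH ((hs H).1 h).2) ⟨h1, fun H hH => h'.mem H fun h =>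
      hH ((hK.toward.sameSector_iff hX h1).1 h).2, h'.max⟩
  · exact absurd (hS K fun h => hK.1.not_sameSector ((hs K).1 h).1) (h'.max K u hu)

theorem IsMaxPath.unique (hX : IsQuasiMedian X) {α : GraphAction G X} {S : Set (HypOrbit α)}
    {v w w' : V} (h : IsMaxPath α q S v w) (h' : IsMaxPath α q S v w') : w = w' := by
  have h1 : X.dist w w' + X.dist w' q = X.dist w q := h'.toward_of_toward hX h.toward h.mem
  have h2 : X.dist w' w + X.dist w q = X.dist w' q := h.toward_of_toward hX h'.toward h'.mem
  exact hX.connected.dist_eq_zero_iff.1 (by omega)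

/-- The sets of hyperplane types used for the paths starting at `v` and moving towards `q`. -/
def startTypes (α : GraphAction G X) (q v : V) : Set (Set (HypOrbit α)) :=
  {S | S = ∅ ∨ ∃ (H : Hyperplane X) (z : V) (O : HypOrbit α), Up q H v z ∧
    α.Star (α.type H) O ∧ ∀ s ∈ S, α.Star O s}

theorem startTypes_finite (hX : IsQuasiMedian X) {α : GraphAction G X} (hsp : IsSpecial α) {D : ℕ}
    (hD : QuotDegBounded α D) (q v : V) : (startTypes α q v).Finite ∧
      (startTypes α q v).ncard ≤ (D + 1) ^ 2 * 2 ^ (D + 1) := by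
  by_cases hup : ∃ (H : Hyperplane X) (z : V), Up q H v z
  · obtain ⟨H₀, z₀, h₀⟩ := hup
    have hstar := star_finite hX hsp hD
    obtain ⟨hfin, hcard⟩ := ncard_biUnion_le_mul (hstar (α.type H₀)).1 (hstar (α.type H₀)).2
      (f := fun t => ⋃ O ∈ {O | α.Star t O}, 𝒫 {s | α.Star O s})
      (b := (D + 1) * 2 ^ (D + 1)) fun t _ =>
      ncard_biUnion_le_mul (hstar t).1 (hstar t).2 fun O _ =>
        ⟨(hstar O).1.powerset, by
          rw [Set.ncard_powerset _ (hstar O).1]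
          exact Nat.pow_le_pow_right two_pos (hstar O).2⟩
    have hsub : startTypes α q v ⊆ ⋃ t ∈ {t | α.Star (α.type H₀) t},
        ⋃ O ∈ {O | α.Star t O}, 𝒫 {s | α.Star O s} := by
      rintro S hS
      simp only [Set.mem_iUnion, Set.mem_ofPred_eq, Set.mem_powerset_iff, exists_prop]
      rcases hS with rfl | ⟨H, z, O, hz, hO, hS⟩
      · exact ⟨_, .inl rfl, _, .inl rfl, Set.empty_subset _⟩
      · refine ⟨α.type H, ?_, O, hO, hS⟩
        by_cases hne : H₀ = H
        · exact .inl (congrArg _ hne.symm)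
        · obtain ⟨s, -, -, hcross⟩ := h₀.square hX hz hne
          exact .inr (GraphAction.perp_of_hypIntersect hcross)
    refine ⟨hfin.subset hsub, (Set.ncard_le_ncard hsub hfin).trans (hcard.trans_eq (by ring))⟩
  · have hsub : startTypes α q v ⊆ {∅} := by
      rintro S (rfl | ⟨H, z, O, hz, -⟩)
      · rfl
      · exact absurd ⟨H, z, hz⟩ hup
    refine ⟨(Set.finite_singleton _).subset hsub, (Set.ncard_le_ncard hsub).trans ?_⟩
    rw [Set.ncard_singleton]
    exact Nat.succ_le_of_lt (by positivity)

/-- The vertices reached from `p` by `n` successive maximal paths towards `q`. -/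
def canon (α : GraphAction G X) (q p : V) : ℕ → Set V
  | 0 => {p}
  | n + 1 => {w | ∃ v ∈ canon α q p n, ∃ S ∈ startTypes α q v, IsMaxPath α q S v w}

theorem canon_finite (hX : IsQuasiMedian X) {α : GraphAction G X} (hsp : IsSpecial α) {D : ℕ}
    (hD : QuotDegBounded α D) (q p : V) (n : ℕ) : (canon α q p n).Finite ∧
      (canon α q p n).ncard ≤ ((D + 1) ^ 2 * 2 ^ (D + 1)) ^ n := by
  induction n with
  | zero => exact ⟨Set.finite_singleton _, by simp [canon]⟩
  | succ n ih =>
    have e : canon α q p (n + 1) = ⋃ v ∈ canon α q p n, ⋃ S ∈ startTypes α q v,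
        {w | IsMaxPath α q S v w} := by
      ext w
      simp [canon]
    rw [e, pow_succ]
    refine ncard_biUnion_le_mul ih.1 ih.2 fun v _ => ?_
    have hs := startTypes_finite hX hsp hD q v
    have := ncard_biUnion_le_mul hs.1 hs.2 (f := fun S => {w | IsMaxPath α q S v w}) (b := 1)
      fun S _ => ?_
    · simpa using this
    · have hsub : {w | IsMaxPath α q S v w}.Subsingleton := fun w hw w' hw' =>
        IsMaxPath.unique hX hw hw'
      exact ⟨hsub.finite, (Set.ncard_le_one hsub.finite).2 hsub⟩

theorem canon_mono (α : GraphAction G X) (q p : V) : Monotone (canon α q p) :=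
  monotone_nat_of_le_succ fun _ v hv => ⟨v, hv, ∅, .inl rfl, .refl _ _,
    fun _ hH => absurd (.refl _ _) hH, fun _ _ _ => Set.notMem_empty _⟩

theorem mem_canon_succ (hX : IsQuasiMedian X) {α : GraphAction G X} {p v w : V} {n : ℕ}
    (hv : v ∈ canon α q p n) (h : Toward X q v w) (O : HypOrbit α)
    (hO : ∀ H : Hyperplane X, ¬ SameSector H v w → α.Star O (α.type H))
    (hmax : ∀ H K : Hyperplane X, ∀ z, Up q H w z → ¬ SameSector K v w →
      α.type H ≠ α.type K) : w ∈ canon α q p (n + 1) := by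
  refine ⟨v, hv, {t | ∃ K : Hyperplane X, ¬ SameSector K v w ∧ α.type K = t}, ?_, h,
    fun H hH => ⟨H, hH, rfl⟩, fun H z hz ⟨K, hK, hHK⟩ => hmax H K z hz hK hHK.symm⟩
  by_cases hvw : v = w
  · left
    subst hvw
    ext t
    simp [SameSector.refl]
  · right
    obtain ⟨z, hvz, -, hz, hzw⟩ := h.exists_first hX.connected hvw
    obtain ⟨H, hH⟩ := exists_up hvz hz
    have hs : ¬ SameSector H v w := fun h' =>
      hH.1.not_sameSector ((hH.toward.sameSector_iff hX hzw).1 h').1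
    refine ⟨H, z, O, hH, ?_, ?_⟩
    · exact (hO H hs).imp Eq.symm GraphAction.Perp.symm
    · rintro s ⟨K, hK, rfl⟩
      exact hO K hK

section Equivariance

variable (α : GraphAction G X)

theorem dist_act_le (hc : X.Connected) (g : G) (v w : V) :
    X.dist (α.act g v) (α.act g w) ≤ X.dist v w := by
  obtain ⟨p, hp⟩ := hc.exists_walk_length_eq_dist v w
  let f : X →g X := ⟨α.act g, fun {a b} h => (α.act_adj g a b).2 h⟩
  exact (SimpleGraph.dist_le (p.map f)).trans_eq ((SimpleGraph.Walk.length_map f p).trans hp)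

theorem dist_act (hc : X.Connected) (g : G) (v w : V) :
    X.dist (α.act g v) (α.act g w) = X.dist v w := by
  refine (dist_act_le α hc g v w).antisymm ?_
  have h := dist_act_le α hc g⁻¹ (α.act g v) (α.act g w)
  rwa [α.act_inv_act, α.act_inv_act] at h

theorem SameSector.act (hc : X.Connected) {H : Hyperplane X} {v w : V} (h : SameSector H v w)
    (g : G) : SameSector (α.hyp g H) (α.act g v) (α.act g w) := by
  intro a b hab
  have hab' := α.dual_hyp g⁻¹ hab
  rw [α.hyp_inv_hyp] at hab'
  have e : ∀ u, distDiff X a b (α.act g u) = distDiff X (α.act g⁻¹ a) (α.act g⁻¹ b) u := by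
    intro u
    rw [distDiff, distDiff, ← dist_act α hc g⁻¹, α.act_inv_act,
      ← dist_act α hc g⁻¹ (α.act g u), α.act_inv_act]
  rw [e, e]
  exact h _ _ hab'

theorem Up.act (hc : X.Connected) {H : Hyperplane X} {v w : V} (h : Up q H v w) (g : G) :
    Up (α.act g q) (α.hyp g H) (α.act g v) (α.act g w) :=
  ⟨α.dual_hyp g h.1, by rw [dist_act α hc, dist_act α hc, h.2]⟩

variable {α}

theorem IsMaxPath.act (hc : X.Connected) {S : Set (HypOrbit α)} {v w : V}
    (h : IsMaxPath α q S v w) (g : G) :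
    IsMaxPath α (α.act g q) S (α.act g v) (α.act g w) where
  toward := by
    rw [Toward, dist_act α hc, dist_act α hc, dist_act α hc]
    exact h.toward
  mem H hH := by
    rw [← α.type_hyp g⁻¹ H]
    refine h.mem _ fun h' => hH ?_
    have := h'.act α hc g
    rwa [α.hyp_hyp_inv] at this
  max H z hz := by
    have := hz.act α hc g⁻¹
    rw [α.act_inv_act, α.act_inv_act] at this
    rw [← α.type_hyp g⁻¹ H]
    exact h.max _ _ this

theorem canon_act (hc : X.Connected) (g : G) {p w : V} {n : ℕ} (h : w ∈ canon α q p n) :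
    α.act g w ∈ canon α (α.act g q) (α.act g p) n := by
  induction n generalizing w with
  | zero => exact congrArg (α.act g) h
  | succ n ih =>
    obtain ⟨v, hv, S, hS, hw⟩ := h
    refine ⟨_, ih hv, S, hS.imp_right ?_, hw.act hc g⟩
    rintro ⟨H, z, O, hz, hO, hs⟩
    exact ⟨_, _, O, hz.act α hc g, by rwa [α.type_hyp], hs⟩

end Equivariance

end QM

namespace QM

variable {V : Type*} {X : SimpleGraph V} {q : V} {G : Type*} [Group G]

theorem sameSector_of_mem_hypCarrier (hX : IsQuasiMedian X) {α : GraphAction G X}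
    {B H : Hyperplane X} (hH : 1 < (contactGraph X).dist B H) {v w : V}
    (hv : v ∈ hypCarrier X B) (hw : w ∈ hypCarrier X B) : SameSector H v w := by
  have h := eqvGen_stepIn α hv hw
  clear hv hw
  induction h with
  | rel v w h =>
    obtain ⟨hv, -, K, hK, -⟩ := h
    obtain ⟨b, hb⟩ := mem_hypCarrier.1 hv
    rw [hK.sameSector_iff_ne hX]
    rintro rfl
    exact hH.not_ge (dual_reachable hb hK).1
  | refl => exact .refl _ _
  | symm _ _ _ ih => exact ih.symm
  | trans _ _ _ _ _ ih1 ih2 => exact ih1.trans ih2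

theorem sameSector_of_chain (hX : IsQuasiMedian X) {α : GraphAction G X} {B : ℕ → Hyperplane X}
    {H : Hyperplane X} {v : V} (hv : v ∈ hypCarrier X (B 0)) (k : ℕ)
    (hB : ∀ i < k, ∃ u, u ∈ hypCarrier X (B i) ∧ u ∈ hypCarrier X (B (i + 1)))
    (hH : ∀ i ≤ k, 1 < (contactGraph X).dist (B i) H) {w : V} (hw : w ∈ hypCarrier X (B k)) :
    SameSector H v w := by
  induction k generalizing w with
  | zero => exact sameSector_of_mem_hypCarrier (α := α) hX (hH 0 le_rfl) hv hw
  | succ k ih =>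
    obtain ⟨u, hu, hu'⟩ := hB k (Nat.lt_succ_self k)
    exact (ih (fun i hi => hB i (by omega)) (fun i hi => hH i (by omega)) hu).trans
      (sameSector_of_mem_hypCarrier (α := α) hX (hH (k + 1) le_rfl) hu' hw)

theorem SameSector.up_iff {H : Hyperplane X} {q q' v w : V} (h : SameSector H q q') :
    Up q H v w ↔ Up q' H v w := by
  refine and_congr_right fun hd => ?_
  have := h v w hd
  simp only [distDiff] at this
  rw [X.dist_comm, X.dist_comm (v := q), X.dist_comm (u := w) (v := q'),
    X.dist_comm (u := v) (v := q')]
  omega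

theorem Toward.of_sameSector (hX : IsQuasiMedian X) {q q' v w : V} (h : Toward X q v w)
    (hs : ∀ H : Hyperplane X, ¬ SameSector H v w → SameSector H q q') : Toward X q' v w := by
  revert hs
  refine Toward.induction (q := q) hX.connected (P := fun v w =>
    (∀ H : Hyperplane X, ¬ SameSector H v w → SameSector H q q') → Toward X q' v w)
    (fun v _ => .refl _ _) ?_ h
  intro v z w hvz hz hzw _ ih hs
  obtain ⟨K, hK⟩ := exists_up hvz hz
  have hi := fun L => hK.toward.sameSector_iff (H := L) hX hzw
  have hK' := (hs K fun h' => hK.1.not_sameSector ((hi K).1 h').1).up_iff.1 hK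
  exact (hK'.toward.trans hX.connected (ih fun H hH => hs H fun h' => hH ((hi H).1 h').2)).1

theorem exists_chain (hX : IsQuasiMedian X) (A A' : Hyperplane X) :
    ∃ B : ℕ → Hyperplane X, B 0 = A ∧ B ((contactGraph X).dist A A') = A' ∧
      (∀ i < (contactGraph X).dist A A',
        ∃ v, v ∈ hypCarrier X (B i) ∧ v ∈ hypCarrier X (B (i + 1))) ∧
      ∀ i, (contactGraph X).dist A (B i) ≤ i := by
  have hc := contactGraph_connected hX.connected A
  obtain ⟨p, hp⟩ := hc.exists_walk_length_eq_dist A A'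
  refine ⟨p.getVert, p.getVert_zero, by rw [← hp, p.getVert_length], fun i hi => ?_, fun i => ?_⟩
  · have h := p.adj_getVert_succ (hp ▸ hi)
    have key : ∀ {H K : Hyperplane X}, HypIntersect X H K ∨ HypOsculate X H K →
        ∃ v, v ∈ hypCarrier X H ∧ v ∈ hypCarrier X K := by
      rintro H K (⟨v, e, he, e', he', a, b, rfl, rfl, -⟩ | ⟨v, e, he, e', he', a, b, rfl, rfl, -⟩)
        <;> exact ⟨v, mem_hypCarrier.2 ⟨a, he⟩, mem_hypCarrier.2 ⟨b, he'⟩⟩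
    rcases ((SimpleGraph.fromRel_adj _ _ _).1 h).2 with h | h
    · exact key h
    · exact (key h).imp fun _ => And.symm
  · refine (SimpleGraph.dist_le (p.take i)).trans ?_
    rw [SimpleGraph.Walk.take_length]
    exact min_le_left _ _

theorem exists_canon_pair (hX : IsQuasiMedian X) {α : GraphAction G X} (hsp : IsSpecial α)
    {A B : Hyperplane X} {ε : ℕ} (hAB : 2 * ε + 6 ≤ (contactGraph X).dist A B) {p q : V}
    (hp : p ∈ hypCarrier X A) (hq : q ∈ hypCarrier X B) {g : G}
    (hA : (contactGraph X).dist A (α.hyp g A) ≤ ε)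
    (hB : (contactGraph X).dist B (α.hyp g B) ≤ ε) :
    ∃ a ∈ canon α q p (ε + 1), ∃ b ∈ canon α q p (ε + 1), α.act g b = a := by
  have hc := hX.connected
  have hcc := contactGraph_connected hc A
  have carrier_act : ∀ {v : V} {H : Hyperplane X}, v ∈ hypCarrier X H →
      α.act g v ∈ hypCarrier X (α.hyp g H) := by
    intro v H hv
    obtain ⟨b, hb⟩ := mem_hypCarrier.1 hv
    exact mem_hypCarrier.2 ⟨_, α.dual_hyp g hb⟩
  obtain ⟨C, hC0, hCk, hC, hCd⟩ := exists_chain hX A (α.hyp g A)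
  obtain ⟨E, hE0, hEk, hE, hEd⟩ := exists_chain hX B (α.hyp g B)
  set k := (contactGraph X).dist A (α.hyp g A)
  set l := (contactGraph X).dist B (α.hyp g B)
  have far : ∀ i < k + 1, ∀ H, (contactGraph X).dist (C i) H ≤ 2 →
      SameSector H q (α.act g q) := by
    intro i hi H hH
    refine sameSector_of_chain (α := α) hX (hE0 ▸ hq) l hE (fun j hj => ?_)
      (hEk ▸ carrier_act hq)
    have h1 := hCd i
    have h2 := hEd j
    have h3 := hcc.dist_triangle (u := A) (v := C i) (w := H)
    have h4 := hcc.dist_triangle (u := A) (v := H) (w := B)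
    have h5 := hcc.dist_triangle (u := B) (v := E j) (w := H)
    rw [SimpleGraph.dist_comm (u := B) (v := H)] at h5
    omega
  obtain ⟨x, y, c, hch, -⟩ := exists_biChain (q := q) hX hsp (hC0 ▸ hp) k hC (α.act g p)
    (hCk ▸ carrier_act hp)
  obtain ⟨x, y, c, hch, hnx, hny⟩ := hch.exists_normal hX hsp
  have hx : ∀ i ≤ k + 1, x i ∈ canon α q p i := by
    intro i
    induction i with
    | zero => exact fun _ => hch.start
    | succ i ih =>
      exact fun hi => mem_canon_succ hX (ih (by omega)) (hch.towardX i hi) _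
        (fun H hH => (hch.starX i hi H hH).1) (hnx i hi)
  have hy : ∀ i ≤ k + 1, y (k + 1 - i) ∈ canon α (α.act g q) (α.act g p) i := by
    intro i
    induction i with
    | zero => exact fun _ => hch.finish
    | succ i ih =>
      intro hi
      have ih := ih (by omega)
      have hlt : k + 1 - (i + 1) < k + 1 := by omega
      have e : k + 1 - i = k + 1 - (i + 1) + 1 := by omega
      rw [e] at ih
      generalize k + 1 - (i + 1) = j at *
      have hs := hch.starY j hlt
      refine mem_canon_succ hX ih ((hch.towardY j hlt).of_sameSector hX fun H hH =>
        far j hlt H ((hs H hH).2.trans one_le_two)) (α.type (C j)) (fun H hH => (hs H hH).1) ?_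
      intro H K z hz hK
      refine hny j hlt H K z ((far j hlt H ?_).up_iff.2 hz) hK
      have hne : y (j + 1) ≠ y j := fun h => hK (h ▸ .refl _ _)
      obtain ⟨u, hu, hd, -, hyu⟩ := (hch.towardY j hlt).exists_last hc hne
      obtain ⟨L, hL⟩ := exists_dual hu
      have h1 : Toward X (y j) (y (j + 1)) u := by
        rw [Toward, dist_le_one_of_adj hu, hd]
      have h2 : Toward X (y j) u (y j) := by simp [Toward]
      have hLs : ¬ SameSector L (y (j + 1)) (y j) := fun h =>
        hL.not_sameSector ((h1.sameSector_iff hX h2).1 h).2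
      have h3 := (hs L hLs).2
      have h4 := (dual_reachable hL.symm hz.1).1
      have h5 := hcc.dist_triangle (u := C j) (v := L) (w := H)
      omega
  have hk : k + 1 ≤ ε + 1 := by omega
  have hyg := canon_act hc g⁻¹ (hy (k + 1) le_rfl)
  rw [Nat.sub_self, ← hch.mid, α.act_inv_act, α.act_inv_act] at hyg
  exact ⟨_, canon_mono α q p hk (hx _ le_rfl), _, canon_mono α q p hk hyg, α.act_act_inv _ _⟩

theorem translateDistLE_iff {α : GraphAction G X} {g : G} {A : Hyperplane X} {ε : ℕ} :
    TranslateDistLE α g A ε ↔ (contactGraph X).dist A (α.hyp g A) ≤ ε := by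
  constructor
  · rintro ⟨A', hA', h⟩
    obtain rfl : A' = α.hyp g A := Subtype.ext hA'
    exact_mod_cast h
  · exact fun h => ⟨α.hyp g A, rfl, by exact_mod_cast h⟩

theorem transporter_finite {α : GraphAction G X} {D : ℕ}
    (hstab : ∀ w : V, {g : G | α.act g w = w}.Finite ∧ {g : G | α.act g w = w}.ncard ≤ D)
    (a b : V) : {g : G | α.act g b = a}.Finite ∧ {g : G | α.act g b = a}.ncard ≤ D := by
  rcases {g : G | α.act g b = a}.eq_empty_or_nonempty with h | ⟨g₀, h₀⟩
  · simp [h]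
  · have hsub : {g : G | α.act g b = a} ⊆ (fun g => g₀ * g) '' {g : G | α.act g b = b} := by
      intro g hg
      refine ⟨g₀⁻¹ * g, ?_, by simp⟩
      change α.act (g₀⁻¹ * g) b = b
      have h₀ : α.act g₀ b = a := h₀
      have hg : α.act g b = a := hg
      rw [α.act_mul, hg, ← h₀, α.act_inv_act]
    have hfin := (hstab b).1.image (fun g => g₀ * g)
    exact ⟨hfin.subset hsub, (Set.ncard_le_ncard hsub hfin).trans
      ((Set.ncard_image_le (hstab b).1).trans (hstab b).2)⟩

theorem translates_finite (hX : IsQuasiMedian X) {α : GraphAction G X} (hsp : IsSpecial α) {D : ℕ}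
    (hstab : ∀ w : V, {g : G | α.act g w = w}.Finite ∧ {g : G | α.act g w = w}.ncard ≤ D)
    (hD : QuotDegBounded α D) {A B : Hyperplane X} {ε : ℕ}
    (hAB : 2 * ε + 6 ≤ (contactGraph X).dist A B) :
    {g : G | TranslateDistLE α g A ε ∧ TranslateDistLE α g B ε}.Finite ∧
      {g : G | TranslateDistLE α g A ε ∧ TranslateDistLE α g B ε}.ncard ≤
        D * ((D + 1) ^ 2 * 2 ^ (D + 1)) ^ (2 * (ε + 1)) := by
  obtain ⟨p, a, hp⟩ := exists_dual_of_hyperplane A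
  obtain ⟨q, b, hq⟩ := exists_dual_of_hyperplane B
  have hcan := canon_finite hX hsp hD q p (ε + 1)
  obtain ⟨hfin, hcard⟩ := ncard_biUnion_le_mul hcan.1 hcan.2
    (f := fun a => ⋃ b ∈ canon α q p (ε + 1), {g : G | α.act g b = a}) fun a _ =>
    ncard_biUnion_le_mul hcan.1 hcan.2 fun b _ => transporter_finite hstab a b
  have hsub : {g : G | TranslateDistLE α g A ε ∧ TranslateDistLE α g B ε} ⊆
      ⋃ a ∈ canon α q p (ε + 1), ⋃ b ∈ canon α q p (ε + 1), {g : G | α.act g b = a} := by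
    rintro g ⟨hA, hB⟩
    obtain ⟨a, ha, b, hb, hab⟩ := exists_canon_pair hX hsp hAB (mem_hypCarrier.2 ⟨_, hp⟩)
      (mem_hypCarrier.2 ⟨_, hq⟩) (translateDistLE_iff.1 hA) (translateDistLE_iff.1 hB)
    simp only [Set.mem_iUnion, exists_prop]
    exact ⟨a, ha, b, hb, hab⟩
  refine ⟨hfin.subset hsub, (Set.ncard_le_ncard hsub hfin).trans (hcard.trans_eq (by ring))⟩

end QM

namespace QM

/-- **Theorem (explicit acylindricity).** If `G` acts specially on a quasi-median graph `X`,
vertex stabilisers have cardinality at most `D`, and every vertex of `ΔX/G` has at most `D`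
neighbours, then the induced action of `G` on `𝒞X` is acylindrical with constants
`D_ε = 2ε + 6` and `N_ε = D·N^{2(ε+3)}/(N-1)²`, where `N = (D+1)²·2^{D+1}`. -/
theorem acylindrical_explicit_constants {V : Type*} {G : Type*} [Group G]
    (X : SimpleGraph V) (hX : IsQuasiMedian X) (α : GraphAction G X) (hsp : IsSpecial α)
    (D : ℕ)
    (hstab : ∀ w : V, {g : G | α.act g w = w}.Finite ∧ {g : G | α.act g w = w}.ncard ≤ D)
    (hD : QuotDegBounded α D) :
    ∀ ε : ℕ, ∀ A B : Hyperplane X,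
      (2 * (ε : ℝ) + 6) ≤ ((contactGraph X).dist A B : ℝ) →
      {g : G | TranslateDistLE α g A (ε : ℝ) ∧ TranslateDistLE α g B (ε : ℝ)}.Finite ∧
      ({g : G | TranslateDistLE α g A (ε : ℝ) ∧ TranslateDistLE α g B (ε : ℝ)}.ncard : ℝ) ≤
        (D : ℝ) * (((D : ℝ) + 1) ^ 2 * 2 ^ (D + 1)) ^ (2 * (ε + 3)) /
          ((((D : ℝ) + 1) ^ 2 * 2 ^ (D + 1)) - 1) ^ 2 := by
  intro ε A B hAB
  obtain ⟨hfin, hcard⟩ := translates_finite hX hsp hstab hD (ε := ε) (by exact_mod_cast hAB)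
  refine ⟨hfin, ?_⟩
  have hcard' : ({g : G | TranslateDistLE α g A (ε : ℝ) ∧
      TranslateDistLE α g B (ε : ℝ)}.ncard : ℝ) ≤
        D * (((D : ℝ) + 1) ^ 2 * 2 ^ (D + 1)) ^ (2 * (ε + 1)) := by exact_mod_cast hcard
  have hN : (2 : ℝ) ≤ ((D : ℝ) + 1) ^ 2 * 2 ^ (D + 1) := by
    have h1 : (1 : ℝ) ≤ ((D : ℝ) + 1) ^ 2 := one_le_pow₀ (by simp)
    have h2 : (2 : ℝ) ≤ 2 ^ (D + 1) := le_self_pow₀ one_le_two (Nat.succ_ne_zero D)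
    nlinarith
  generalize ((D : ℝ) + 1) ^ 2 * 2 ^ (D + 1) = N at hN hcard' ⊢
  refine hcard'.trans ?_
  rw [le_div_iff₀ (by nlinarith), mul_assoc]
  refine mul_le_mul_of_nonneg_left ?_ (Nat.cast_nonneg D)
  rw [show 2 * (ε + 3) = 2 * (ε + 1) + 4 by ring, pow_add]
  refine mul_le_mul_of_nonneg_left ?_ (by positivity)
  calc (N - 1) ^ 2 ≤ N ^ 2 := pow_le_pow_left₀ (by linarith) (by linarith) 2
    _ ≤ N ^ 4 := pow_le_pow_right₀ (by linarith) (by norm_num)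

end QM
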